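/- arXiv:1705.10592 — 7 statements merged into one kernel-verified Lean document; each statement's English description precedes it below -/
import Mathlib

section
/- Let q be a prime power, m, n, μ positive integers, and let C_2 ⊊ C_1 ⊆ F_{q^m}^n be F_{q^m}-linear codes. If B ∈ F_q^{μ×n} satisfies rank(B) < d_R(C_2^⊥, C_1^⊥), then C_2 B^T = C_1 B^T. -/
open Matrix

/-- The rank over `Fq` of a row vector with entries in `Fqm`. -/
noncomputable def rkVec (Fq : Type*) [Field Fq] {Fqm : Type*} [Field Fqm] [Algebra Fq Fqm]
    {n : ℕ} (v : Fin n → Fqm) : ℕ :=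
  Module.finrank Fq (Submodule.span Fq (Set.range v))

/-- The relative minimum rank distance `d_R(C1, C2)` of (sets of) codewords. -/
noncomputable def dRel (Fq : Type*) [Field Fq] {Fqm : Type*} [Field Fqm] [Algebra Fq Fqm]
    {n : ℕ} (C1 C2 : Set (Fin n → Fqm)) : ℕ :=
  sInf {r | ∃ c ∈ C1, c ∉ C2 ∧ rkVec Fq c = r}

/-- The dual code w.r.t. the standard bilinear form `⟨x,y⟩ = ∑ i, x i * y i`. -/
def dualCode {K : Type*} [Field K] {n : ℕ} (C : Set (Fin n → K)) : Submodule K (Fin n → K) where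
  carrier := {y | ∀ x ∈ C, ∑ i, x i * y i = 0}
  zero_mem' := by intro x hx; simp
  add_mem' := by
    intro a b ha hb x hx
    have h1 := ha x hx
    have h2 := hb x hx
    simp only [Pi.add_apply, mul_add, Finset.sum_add_distrib, h1, h2, add_zero]
  smul_mem' := by
    intro c y hy x hx
    have h := hy x hx
    simp only [Pi.smul_apply, smul_eq_mul]
    calc ∑ i, x i * (c * y i) = c * ∑ i, x i * y i := by
          rw [Finset.mul_sum]; congr 1; ext i; ring
      _ = 0 := by rw [h, mul_zero]

/-- The `Fqm`-row space of a matrix over `Fq`. -/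
noncomputable def rowSpace (Fq : Type*) [Field Fq] (Fqm : Type*) [Field Fqm] [Algebra Fq Fqm]
    {μ n : ℕ} (B : Matrix (Fin μ) (Fin n) Fq) : Submodule Fqm (Fin n → Fqm) :=
  Submodule.span Fqm (Set.range fun i : Fin μ => fun j : Fin n => algebraMap Fq Fqm (B i j))

/-- Combining the rows of a matrix over `Fq` does not raise the rank over `Fq`. -/
theorem rkVec_vecMul_le_rank {Fq Fqm : Type*} [Field Fq] [Field Fqm] [Algebra Fq Fqm]
    {μ n : ℕ} (B : Matrix (Fin μ) (Fin n) Fq) (w : Fin μ → Fqm) :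
    rkVec Fq (w ᵥ* B.map (algebraMap Fq Fqm)) ≤ B.rank := by
  have h : w ᵥ* B.map (algebraMap Fq Fqm) = Fintype.linearCombination Fq w ∘ B.col := by
    ext j
    simp [Matrix.vecMul, dotProduct, Fintype.linearCombination_apply, Algebra.smul_def, mul_comm]
  rw [rkVec, h, Set.range_comp, Submodule.span_image, Matrix.rank_eq_finrank_span_cols]
  exact Submodule.finrank_map_le _ _

/-- if `rank B < d_R(C2^⊥, C1^⊥)` then `C2 Bᵀ = C1 Bᵀ`. -/
theorem stmt1 {Fq Fqm : Type*} [Field Fq] [Field Fqm] [Algebra Fq Fqm]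
    [Fintype Fq] [Fintype Fqm]
    (q m n μ : ℕ) (hq : IsPrimePow q) (hm : 0 < m) (hn : 0 < n) (hμ : 0 < μ)
    (hcq : Fintype.card Fq = q) (hcqm : Fintype.card Fqm = q ^ m)
    (C1 C2 : Submodule Fqm (Fin n → Fqm)) (hsub : C2 < C1)
    (B : Matrix (Fin μ) (Fin n) Fq)
    (hB : B.rank < dRel Fq (dualCode (C2 : Set (Fin n → Fqm)) : Set (Fin n → Fqm))
        (dualCode (C1 : Set (Fin n → Fqm)) : Set (Fin n → Fqm))) :
    Submodule.map (Matrix.mulVecLin (B.map (algebraMap Fq Fqm))) C2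
      = Submodule.map (Matrix.mulVecLin (B.map (algebraMap Fq Fqm))) C1 := by
  refine le_antisymm (Submodule.map_mono hsub.le) ?_
  rintro _ ⟨c, hc, rfl⟩
  by_contra hnot
  obtain ⟨f, hf, hker⟩ := Submodule.exists_le_ker_of_notMem hnot
  obtain ⟨w, rfl⟩ := (dotProductEquiv Fqm (Fin μ)).surjective f
  have key (x : Fin n → Fqm) :
      ∑ i, x i * (w ᵥ* B.map (algebraMap Fq Fqm)) i
        = dotProductEquiv Fqm (Fin μ) w ((B.map (algebraMap Fq Fqm)).mulVecLin x) := by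
    change x ⬝ᵥ _ = w ⬝ᵥ _
    rw [Matrix.mulVecLin_apply, Matrix.dotProduct_mulVec, dotProduct_comm]
  refine hB.not_ge (le_trans ?_ (rkVec_vecMul_le_rank B w))
  refine Nat.sInf_le ⟨w ᵥ* B.map (algebraMap Fq Fqm), ?_, ?_, rfl⟩
  · intro x hx
    rw [key]
    exact hker (Submodule.mem_map_of_mem hx)
  · intro hmem
    exact hf ((key c).symm.trans (hmem c hc))
end

section
/- Let q be a prime power, m, n positive integers, and C_2 ⊊ C_1 ⊆ F_{q^m}^n F_{q^m}-linear codes. Then d_R(C_1, C_2) = min{ rank(A) : ν ∈ ℕ, A ∈ F_q^{ν×n}, and C_1 ∩ Row(A) ⊄ C_2 }, where Row(A) ⊆ F_{q^m}^n is the F_{q^m}-span of the rows of A and the condition C_1 ∩ Row(A) ⊄ C_2 says that dim(C_1 ∩ Row(A) / C_2 ∩ Row(A)) ≥ 1. -/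
open Matrix

/-- A vector lies in the row space of a matrix over `Fq` with at most `rkVec Fq c` rows. -/
theorem exists_mem_rowSpace_rank_le_rkVec (Fq : Type*) {Fqm : Type*} [Field Fq] [Field Fqm]
    [Algebra Fq Fqm] {n : ℕ} (c : Fin n → Fqm) :
    ∃ A : Matrix (Fin (rkVec Fq c)) (Fin n) Fq,
      c ∈ rowSpace Fq Fqm A ∧ A.rank ≤ rkVec Fq c := by
  have : Module.Finite Fq (Submodule.span Fq (Set.range c)) :=
    Module.Finite.span_of_finite Fq (Set.finite_range c)
  let b := Module.finBasis Fq (Submodule.span Fq (Set.range c))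
  let w : Fin n → Submodule.span Fq (Set.range c) :=
    fun j => ⟨c j, Submodule.subset_span (Set.mem_range_self j)⟩
  refine ⟨Matrix.of fun i j => b.repr (w j) i, ?_, Matrix.rank_le_height _⟩
  have hc : c = ∑ i, (b i : Fqm) • fun j => algebraMap Fq Fqm (b.repr (w j) i) := by
    ext j
    have h := congrArg Subtype.val (b.sum_repr (w j))
    rw [AddSubmonoidClass.coe_finsetSum] at h
    simp only [Finset.sum_apply, Pi.smul_apply, smul_eq_mul]
    refine h.symm.trans (Finset.sum_congr rfl fun i _ => ?_)
    rw [Submodule.coe_smul, Algebra.smul_def, mul_comm]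
  refine Set.mem_of_eq_of_mem hc ?_
  exact Submodule.sum_mem _ fun i _ =>
    Submodule.smul_mem _ _ (Submodule.subset_span ⟨i, rfl⟩)

/-- The rank of a vector in the row space of `A` is at most the rank of `A`. -/
theorem rkVec_le_rank_of_mem_rowSpace {Fq Fqm : Type*} [Field Fq] [Field Fqm]
    [Algebra Fq Fqm] {ν n : ℕ} {A : Matrix (Fin ν) (Fin n) Fq} {c : Fin n → Fqm}
    (hc : c ∈ rowSpace Fq Fqm A) : rkVec Fq c ≤ A.rank := by
  obtain ⟨x, rfl⟩ := (Submodule.mem_span_range_iff_exists_fun Fqm).1 hc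
  let φ := Fintype.linearCombination Fq x
  have hφ : Set.range (∑ i, x i • fun j : Fin n => algebraMap Fq Fqm (A i j))
      = φ '' Set.range A.col := by
    rw [← Set.range_comp]
    congr 1
    ext j
    simp [φ, Fintype.linearCombination_apply, Algebra.smul_def, mul_comm]
  rw [rkVec, hφ, ← Submodule.map_span, Matrix.rank_eq_finrank_span_cols]
  exact Submodule.finrank_map_le _ _

/-- `d_R(C1, C2)` equals the minimum rank of a matrix `A` over `Fq`
(with any number `ν` of rows) such that `C1 ∩ Row(A) ⊄ C2`. -/
theorem stmt4 {Fq Fqm : Type*} [Field Fq] [Field Fqm] [Algebra Fq Fqm]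
    [Fintype Fq] [Fintype Fqm]
    (q m n : ℕ) (hq : IsPrimePow q) (hm : 0 < m) (hn : 0 < n)
    (hcq : Fintype.card Fq = q) (hcqm : Fintype.card Fqm = q ^ m)
    (C1 C2 : Submodule Fqm (Fin n → Fqm)) (hsub : C2 < C1) :
    dRel Fq (C1 : Set (Fin n → Fqm)) (C2 : Set (Fin n → Fqm))
      = sInf {r | ∃ (ν : ℕ) (A : Matrix (Fin ν) (Fin n) Fq),
          ¬ (C1 ⊓ rowSpace Fq Fqm A ≤ C2) ∧ A.rank = r} := by
  refine csInf_eq_csInf_of_forall_exists_le ?_ ?_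
  · rintro _ ⟨c, hc1, hc2, rfl⟩
    obtain ⟨A, hcA, hA⟩ := exists_mem_rowSpace_rank_le_rkVec Fq c
    exact ⟨_, ⟨_, A, fun h => hc2 (h ⟨hc1, hcA⟩), rfl⟩, hA⟩
  · rintro _ ⟨ν, A, hA, rfl⟩
    obtain ⟨c, ⟨hc1, hcA⟩, hc2⟩ := SetLike.not_le_iff_exists.1 hA
    exact ⟨_, ⟨c, hc1, hc2, rfl⟩, rkVec_le_rank_of_mem_rowSpace hcA⟩
end

section
/- Let q be a prime power, m, n ≥ 1 and t, ρ ≥ 0 integers with ρ ≤ n. Let C_2 ⊊ C_1 ⊆ F_{q^m}^n be F_{q^m}-linear codes, set ℓ = dim(C_1) − dim(C_2), let W ⊆ F_{q^m}^n be an F_{q^m}-subspace with C_1 = C_2 ⊕ W, and let ψ : F_{q^m}^ℓ → W be an F_{q^m}-linear isomorphism. Consider the nested coset coding scheme C_S = ψ(S) + C_2 for S ∈ F_{q^m}^ℓ. Then the scheme is universally t-error and ρ-erasure-correcting — i.e., for every N ≥ 1 and every A ∈ F_q^{N×n} of rank at least n − ρ there exists D_A : F_{q^m}^N → F_{q^m}^ℓ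 such that D_A(x A^T + e) = S for every S ∈ F_{q^m}^ℓ, every x ∈ C_S and every e ∈ F_{q^m}^N with Rk_q(e) ≤ t — if and only if 2t + ρ < d_R(C_1, C_2). -/
open Matrix

/-- A vector over `Fqm` has `Fq`-rank at most the dimension of any `Fq`-subspace containing its
entries. -/
theorem rkVec_le_finrank {Fq Fqm : Type*} [Field Fq] [Field Fqm] [Algebra Fq Fqm]
    [FiniteDimensional Fq Fqm] {n : ℕ} {v : Fin n → Fqm} {V : Submodule Fq Fqm}
    (h : ∀ i, v i ∈ V) : rkVec Fq v ≤ Module.finrank Fq V :=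
  Submodule.finrank_mono (Submodule.span_le.2 (Set.range_subset_iff.2 h))

theorem rkVec_sub_le {Fq Fqm : Type*} [Field Fq] [Field Fqm] [Algebra Fq Fqm]
    [FiniteDimensional Fq Fqm] {n : ℕ} (v w : Fin n → Fqm) :
    rkVec Fq (v - w) ≤ rkVec Fq v + rkVec Fq w := by
  refine (rkVec_le_finrank fun i => ?_).trans (Submodule.finrank_add_le_finrank_add_finrank
    (Submodule.span Fq (Set.range v)) (Submodule.span Fq (Set.range w)))
  exact Submodule.sub_mem _
    (Submodule.mem_sup_left (Submodule.subset_span ⟨i, rfl⟩))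
    (Submodule.mem_sup_right (Submodule.subset_span ⟨i, rfl⟩))

theorem rkVec_eq_finrank_range {Fq Fqm : Type*} [Field Fq] [Field Fqm] [Algebra Fq Fqm]
    {n : ℕ} (v : Fin n → Fqm) :
    rkVec Fq v = Module.finrank Fq (LinearMap.range (Fintype.linearCombination Fq v)) := by
  rw [Fintype.range_linearCombination, rkVec]

theorem map_algebraMap_mulVec_apply {Fq Fqm : Type*} [Field Fq] [Field Fqm] [Algebra Fq Fqm]
    {N n : ℕ} (A : Matrix (Fin N) (Fin n) Fq) (c : Fin n → Fqm) (i : Fin N) :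
    (A.map (algebraMap Fq Fqm)).mulVec c i = Fintype.linearCombination Fq c (A.row i) := by
  simp [Matrix.mulVec, dotProduct, Fintype.linearCombination_apply, Algebra.smul_def]

/-- Multiplication by a matrix of rank at least `n - ρ` lowers the rank by at most `ρ`. -/
theorem rkVec_le_rkVec_mulVec_add {Fq Fqm : Type*} [Field Fq] [Field Fqm] [Algebra Fq Fqm]
    [FiniteDimensional Fq Fqm] {N n ρ : ℕ} (A : Matrix (Fin N) (Fin n) Fq)
    (hA : n - ρ ≤ A.rank) (c : Fin n → Fqm) :
    rkVec Fq c ≤ rkVec Fq ((A.map (algebraMap Fq Fqm)).mulVec c) + ρ := by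
  set L := Fintype.linearCombination Fq c with hL
  obtain ⟨U', hU'⟩ := Submodule.exists_isCompl (Submodule.span Fq (Set.range A.row))
  have hdim := Submodule.finrank_add_eq_of_isCompl hU'
  have hrank : A.rank = Module.finrank Fq (Submodule.span Fq (Set.range A.row)) :=
    A.rank_eq_finrank_span_row
  rw [Module.finrank_fin_fun] at hdim
  have hrow : rkVec Fq ((A.map (algebraMap Fq Fqm)).mulVec c) =
      Module.finrank Fq (Submodule.map L (Submodule.span Fq (Set.range A.row))) := by
    have hcomp : (A.map (algebraMap Fq Fqm)).mulVec c = L ∘ A.row :=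
      funext (map_algebraMap_mulVec_apply A c)
    rw [Submodule.map_span, ← Set.range_comp, rkVec, hcomp]
  have hrange : LinearMap.range L = Submodule.map L (Submodule.span Fq (Set.range A.row)) ⊔
      Submodule.map L U' := by
    rw [← Submodule.map_sup, hU'.sup_eq_top, LinearMap.range_eq_map]
  have hsum := Submodule.finrank_add_le_finrank_add_finrank
    (Submodule.map L (Submodule.span Fq (Set.range A.row))) (Submodule.map L U')
  have hU'le := Submodule.finrank_map_le L U'
  rw [rkVec_eq_finrank_range, ← hL, hrange, hrow]
  omega

/-- A subspace of dimension at most `a + b` is a sum of subspaces of dimension at most `a`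
and `b`. -/
theorem exists_sup_eq_of_finrank_le_add {K E : Type*} [Field K] [AddCommGroup E] [Module K E]
    [FiniteDimensional K E] {V : Submodule K E} {a b : ℕ} (h : Module.finrank K V ≤ a + b) :
    ∃ V₁ V₂ : Submodule K E, V₁ ⊔ V₂ = V ∧ Module.finrank K V₁ ≤ a ∧ Module.finrank K V₂ ≤ b := by
  obtain ⟨f, hf⟩ := exists_linearIndependent_of_le_finrank (R := K) (M := V)
    (min_le_right a (Module.finrank K V))
  have hX := finrank_span_eq_card hf
  rw [Fintype.card_fin] at hX
  set X := Submodule.span K (Set.range f)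
  obtain ⟨Y, hY⟩ := Submodule.exists_isCompl X
  have hdim := Submodule.finrank_add_eq_of_isCompl hY
  refine ⟨X.map V.subtype, Y.map V.subtype, ?_, ?_, ?_⟩
  · rw [← Submodule.map_sup, hY.sup_eq_top, Submodule.map_subtype_top]
  · rw [Submodule.finrank_map_subtype_eq]; omega
  · rw [Submodule.finrank_map_subtype_eq]; omega

/-- If the range of `L` is `V ⊔ V'`, then the preimage of `V` has codimension at most
`dim V'`. -/
theorem finrank_le_finrank_comap_add {K E F : Type*} [Field K] [AddCommGroup E] [Module K E]
    [FiniteDimensional K E] [AddCommGroup F] [Module K F] [FiniteDimensional K F]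
    (L : E →ₗ[K] F) {V V' : Submodule K F} (h : V ⊔ V' = LinearMap.range L) :
    Module.finrank K E ≤ Module.finrank K (V.comap L) + Module.finrank K V' := by
  have hdim := (V.mkQ ∘ₗ L).finrank_range_add_finrank_ker
  have hrange : LinearMap.range (V.mkQ ∘ₗ L) = V'.map V.mkQ := by
    rw [LinearMap.range_comp, ← h, Submodule.map_sup, Submodule.mkQ_map_self, bot_sup_eq]
  rw [LinearMap.ker_comp, Submodule.ker_mkQ, hrange] at hdim
  have hle := Submodule.finrank_map_le V.mkQ V'
  omega

/-- A vector of rank at most `2 * t + ρ` is mapped by some matrix of rank at least `n - ρ` to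
a sum of two vectors of rank at most `t`. -/
theorem exists_mulVec_eq_add {Fq Fqm : Type*} [Field Fq] [Finite Fq] [Field Fqm] [Algebra Fq Fqm]
    [FiniteDimensional Fq Fqm] {n t ρ : ℕ} {c : Fin n → Fqm} (hc : rkVec Fq c ≤ 2 * t + ρ) :
    ∃ N, 1 ≤ N ∧ ∃ A : Matrix (Fin N) (Fin n) Fq, n - ρ ≤ A.rank ∧
      ∃ e₁ e₂ : Fin N → Fqm, (A.map (algebraMap Fq Fqm)).mulVec c = e₁ + e₂ ∧
        rkVec Fq e₁ ≤ t ∧ rkVec Fq e₂ ≤ t := by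
  rw [rkVec_eq_finrank_range] at hc
  set L := Fintype.linearCombination Fq c with hL
  obtain ⟨V, V', hV, hVt, hVρ⟩ := exists_sup_eq_of_finrank_le_add hc
  obtain ⟨V₁, V₂, rfl, h₁, h₂⟩ := exists_sup_eq_of_finrank_le_add (hVt.trans_eq (two_mul t))
  have hdim := finrank_le_finrank_comap_add L hV
  rw [Module.finrank_fin_fun] at hdim
  set U := (V₁ ⊔ V₂).comap L with hU
  let f := Finite.equivFin U
  let A : Matrix (Fin (Nat.card U)) (Fin n) Fq := fun i => (f.symm i : Fin n → Fq)
  have hrow : Set.range A.row = U := by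
    have : A.row = Subtype.val ∘ f.symm := rfl
    rw [this, f.symm.surjective.range_comp]
    exact Subtype.range_coe
  have hrank : A.rank = Module.finrank Fq U := by
    rw [A.rank_eq_finrank_span_row, hrow, Submodule.span_eq]
  have hmem (i) : ∃ x ∈ V₁, ∃ y ∈ V₂, x + y = L (A.row i) :=
    Submodule.mem_sup.1 (f.symm i).2
  choose e₁ he₁ e₂ he₂ he using hmem
  refine ⟨Nat.card U, Nat.card_pos, A, by omega, e₁, e₂, ?_,
    (rkVec_le_finrank he₁).trans h₁, (rkVec_le_finrank he₂).trans h₂⟩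
  ext i
  rw [map_algebraMap_mulVec_apply, ← hL, ← he i, Pi.add_apply]

/-- the nested coset coding scheme `C_S = ψ(S) + C_2` is universally
`t`-error and `ρ`-erasure-correcting iff `2t + ρ < d_R(C1, C2)`. -/
theorem stmt5 {Fq Fqm : Type*} [Field Fq] [Field Fqm] [Algebra Fq Fqm]
    [Fintype Fq] [Fintype Fqm]
    (q m n ℓ t ρ : ℕ) (hq : IsPrimePow q) (hm : 0 < m) (hn : 0 < n) (hρn : ρ ≤ n)
    (hcq : Fintype.card Fq = q) (hcqm : Fintype.card Fqm = q ^ m)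
    (C1 C2 : Submodule Fqm (Fin n → Fqm)) (hsub : C2 < C1)
    (hℓ : ℓ = Module.finrank Fqm ↥C1 - Module.finrank Fqm ↥C2)
    (W : Submodule Fqm (Fin n → Fqm))
    (hdisj : C2 ⊓ W = ⊥) (hsup : C2 ⊔ W = C1)
    (ψ : (Fin ℓ → Fqm) ≃ₗ[Fqm] W) :
    (∀ N : ℕ, 1 ≤ N → ∀ A : Matrix (Fin N) (Fin n) Fq, n - ρ ≤ A.rank →
      ∃ D : (Fin N → Fqm) → (Fin ℓ → Fqm),
        ∀ (S : Fin ℓ → Fqm) (x : Fin n → Fqm) (e : Fin N → Fqm),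
          (∃ c ∈ C2, x = (ψ S : Fin n → Fqm) + c) →
          rkVec Fq e ≤ t →
          D ((A.map (algebraMap Fq Fqm)).mulVec x + e) = S)
    ↔ 2 * t + ρ < dRel Fq (C1 : Set (Fin n → Fqm)) (C2 : Set (Fin n → Fqm)) := by
  classical
  have : Module.Finite Fq Fqm := Module.Finite.of_finite
  constructor
  · intro hdec
    by_contra! hd
    have hne : {r : ℕ | ∃ c ∈ (C1 : Set (Fin n → Fqm)), c ∉ (C2 : Set (Fin n → Fqm)) ∧
        rkVec Fq c = r}.Nonempty := by
      obtain ⟨c, hc₁, hc₂⟩ := SetLike.exists_of_lt hsub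
      exact ⟨_, c, hc₁, hc₂, rfl⟩
    obtain ⟨c, hc₁, hc₂, hcd⟩ := Nat.sInf_mem hne
    obtain ⟨N, hN, A, hA, e₁, e₂, he, h₁, h₂⟩ := exists_mulVec_eq_add (hcd.trans_le hd)
    obtain ⟨D, hD⟩ := hdec N hN A hA
    rw [SetLike.mem_coe, ← hsup] at hc₁
    obtain ⟨c₂, hc₂', w, hw, rfl⟩ := Submodule.mem_sup.1 hc₁
    have hneg : rkVec Fq (-e₁) ≤ t :=
      (rkVec_le_finrank (V := Submodule.span Fq (Set.range e₁)) fun i =>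
        Submodule.neg_mem _ (Submodule.subset_span (Set.mem_range_self i))).trans h₁
    have hS := hD (ψ.symm ⟨w, hw⟩) (c₂ + w) (-e₁) ⟨c₂, hc₂', by simp [add_comm]⟩ hneg
    have h0 := hD 0 0 e₂ ⟨0, C2.zero_mem, by simp⟩ h₂
    rw [he, add_neg_cancel_comm] at hS
    rw [Matrix.mulVec_zero, zero_add, hS, LinearEquiv.map_eq_zero_iff, Submodule.mk_eq_zero] at h0
    exact hc₂ (by simpa [h0] using hc₂')
  · intro hd N _ A hA
    let P (y : Fin N → Fqm) (S : Fin ℓ → Fqm) : Prop := ∃ x : Fin n → Fqm, ∃ e : Fin N → Fqm,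
      (∃ c ∈ C2, x = (ψ S : Fin n → Fqm) + c) ∧ rkVec Fq e ≤ t ∧
        (A.map (algebraMap Fq Fqm)).mulVec x + e = y
    have huniq (y S S') (h : P y S) (h' : P y S') : S = S' := by
      obtain ⟨x, e, ⟨c, hc, rfl⟩, he, hy⟩ := h
      obtain ⟨x', e', ⟨c', hc', rfl⟩, he', hy'⟩ := h'
      by_contra hne
      set z := ((ψ S : Fin n → Fqm) + c) - ((ψ S' : Fin n → Fqm) + c') with hz
      have hz' : z = (c - c') + (ψ (S - S') : Fin n → Fqm) := by
        rw [hz, map_sub, Submodule.coe_sub]; abel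
      have hz₁ : z ∈ C1 := by
        rw [hz', ← hsup]
        exact Submodule.add_mem_sup (C2.sub_mem hc hc') (ψ _).2
      have hz₂ : z ∉ C2 := by
        intro hmem
        rw [hz', C2.add_mem_iff_right (C2.sub_mem hc hc')] at hmem
        have h0 : (ψ (S - S') : Fin n → Fqm) ∈ C2 ⊓ W := ⟨hmem, (ψ _).2⟩
        rw [hdisj, Submodule.mem_bot, Submodule.coe_eq_zero, LinearEquiv.map_eq_zero_iff,
          sub_eq_zero] at h0
        exact hne h0
      have hAz : (A.map (algebraMap Fq Fqm)).mulVec z = e' - e := by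
        rw [hz, Matrix.mulVec_sub, sub_eq_sub_iff_add_eq_add, hy, add_comm, hy']
      have hle := rkVec_le_rkVec_mulVec_add A hA z
      have hsub_le := rkVec_sub_le (Fq := Fq) e' e
      have hmin : dRel Fq (C1 : Set (Fin n → Fqm)) (C2 : Set (Fin n → Fqm)) ≤ rkVec Fq z :=
        Nat.sInf_le ⟨z, hz₁, hz₂, rfl⟩
      rw [hAz] at hle
      omega
    refine ⟨fun y => if h : ∃ S, P y S then h.choose else 0, fun S x e hx he => ?_⟩
    have hP : ∃ S', P ((A.map (algebraMap Fq Fqm)).mulVec x + e) S' := ⟨S, x, e, hx, he, rfl⟩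
    refine (dif_pos hP).trans ?_
    exact huniq _ _ _ hP.choose_spec ⟨x, e, hx, he, rfl⟩
end

section
/- Let q be a prime power, m, n ≥ 1, let C_2 ⊊ C_1 ⊆ F_{q^m}^n be F_{q^m}-linear codes and μ ≥ 0 an integer. Then C_1 B^T = C_2 B^T for every B ∈ F_q^{μ×n} if and only if μ < d_R(C_2^⊥, C_1^⊥). (For a nested coset coding scheme C_S = ψ(S) + C_2, this condition is exactly universal security under μ observations: for a uniform message S and codeword uniform on C_S, the observation X B^T is independent of S for every B ∈ F_q^{μ×n}.) -/
open Matrix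

theorem exists_mem_dualCode_sum_ne_zero {K : Type*} [Field K] {n : ℕ}
    (C : Submodule K (Fin n → K)) {x : Fin n → K} (hx : x ∉ C) :
    ∃ y ∈ dualCode (C : Set (Fin n → K)), ∑ i, x i * y i ≠ 0 := by
  obtain ⟨f, hfx, hf⟩ := Submodule.exists_le_ker_of_notMem hx
  have key (z : Fin n → K) : ∑ i, z i * f (fun j => if i = j then 1 else 0) = f z := by
    simpa only [smul_eq_mul] using (LinearMap.pi_apply_eq_sum_univ f z).symm
  refine ⟨fun i => f (fun j => if i = j then 1 else 0), fun z hz => ?_, ?_⟩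
  · rw [key]
    exact hf hz
  · rwa [key]

theorem sum_mulVec_mul_eq_sum_mul_vecMul {K : Type*} [Field K] {n μ : ℕ}
    (A : Matrix (Fin μ) (Fin n) K) (x : Fin n → K) (w : Fin μ → K) :
    ∑ i, (A *ᵥ x) i * w i = ∑ j, x j * (w ᵥ* A) j := by
  change (A *ᵥ x) ⬝ᵥ w = x ⬝ᵥ (w ᵥ* A)
  rw [dotProduct_comm, dotProduct_mulVec, dotProduct_comm]

theorem map_mulVecLin_eq_iff_vecMul_mem_dualCode {K : Type*} [Field K] {n μ : ℕ}
    (A : Matrix (Fin μ) (Fin n) K) {C1 C2 : Submodule K (Fin n → K)} (h : C2 ≤ C1) :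
    C1.map A.mulVecLin = C2.map A.mulVecLin ↔
      ∀ w : Fin μ → K, w ᵥ* A ∈ dualCode (C2 : Set (Fin n → K)) →
        w ᵥ* A ∈ dualCode (C1 : Set (Fin n → K)) := by
  constructor
  · intro he w hw x hx
    obtain ⟨y, hy, hyx⟩ : A.mulVecLin x ∈ C2.map A.mulVecLin :=
      he ▸ Submodule.mem_map_of_mem hx
    rw [mulVecLin_apply, mulVecLin_apply] at hyx
    rw [← sum_mulVec_mul_eq_sum_mul_vecMul, ← hyx, sum_mulVec_mul_eq_sum_mul_vecMul]
    exact hw y hy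
  · intro hw
    refine le_antisymm ?_ (Submodule.map_mono h)
    rintro _ ⟨x, hx, rfl⟩
    by_contra hne
    obtain ⟨w, hwd, hwx⟩ := exists_mem_dualCode_sum_ne_zero _ hne
    rw [mulVecLin_apply, sum_mulVec_mul_eq_sum_mul_vecMul] at hwx
    refine hwx (hw w (fun y hy => ?_) x hx)
    rw [← sum_mulVec_mul_eq_sum_mul_vecMul]
    exact hwd _ (Submodule.mem_map_of_mem hy)

theorem rkVec_le_iff_exists_vecMul {Fq Fqm : Type*} [Field Fq] [Field Fqm] [Algebra Fq Fqm]
    {n μ : ℕ} (c : Fin n → Fqm) :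
    rkVec Fq c ≤ μ ↔ ∃ (B : Matrix (Fin μ) (Fin n) Fq) (w : Fin μ → Fqm),
      w ᵥ* B.map (algebraMap Fq Fqm) = c := by
  have coord (B : Matrix (Fin μ) (Fin n) Fq) (w : Fin μ → Fqm) (j : Fin n) :
      (w ᵥ* B.map (algebraMap Fq Fqm)) j = ∑ i, B i j • w i := by
    simp [vecMul, dotProduct, Algebra.smul_def, mul_comm]
  constructor
  · intro h
    have : FiniteDimensional Fq (Submodule.span Fq (Set.range c)) :=
      FiniteDimensional.span_of_finite Fq (Set.finite_range c)
    obtain ⟨f, -, hf, -⟩ := Submodule.exists_fun_fin_finrank_span_eq Fq (Set.range c)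
    let w : Fin μ → Fqm := Function.extend (Fin.castLE h) f 0
    have hfw : Set.range f ⊆ Set.range w := by
      rintro _ ⟨i, rfl⟩
      exact ⟨Fin.castLE h i, (Fin.castLE_injective h).extend_apply f 0 i⟩
    have hc (j : Fin n) : ∃ b : Fin μ → Fq, ∑ i, b i • w i = c j :=
      (Submodule.mem_span_range_iff_exists_fun Fq).1 <|
        Submodule.span_mono hfw (hf.ge (Submodule.subset_span ⟨j, rfl⟩))
    choose b hb using hc
    exact ⟨fun i j => b j i, w, funext fun j => (coord _ _ j).trans (hb j)⟩
  · rintro ⟨B, w, rfl⟩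
    have hle : Submodule.span Fq (Set.range (w ᵥ* B.map (algebraMap Fq Fqm))) ≤
        Submodule.span Fq (Set.range w) := by
      rw [Submodule.span_le]
      rintro _ ⟨j, rfl⟩
      rw [coord]
      exact Submodule.sum_mem _ fun i _ =>
        Submodule.smul_mem _ _ (Submodule.subset_span ⟨i, rfl⟩)
    have : FiniteDimensional Fq (Submodule.span Fq (Set.range w)) :=
      FiniteDimensional.span_of_finite Fq (Set.finite_range w)
    exact (Submodule.finrank_mono hle).trans <|
      (finrank_range_le_card w).trans_eq (Fintype.card_fin μ)

theorem lt_dRel_iff {Fq Fqm : Type*} [Field Fq] [Field Fqm] [Algebra Fq Fqm]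
    {n μ : ℕ} {D1 D2 : Set (Fin n → Fqm)} (hne : ¬ D1 ⊆ D2) :
    μ < dRel Fq D1 D2 ↔ ∀ c ∈ D1, c ∉ D2 → μ < rkVec Fq c := by
  constructor
  · intro h c h1 h2
    exact h.trans_le (Nat.sInf_le ⟨c, h1, h2, rfl⟩)
  · intro h
    obtain ⟨c, h1, h2⟩ := Set.not_subset.1 hne
    obtain ⟨d, hd1, hd2, hd⟩ :=
      Nat.sInf_mem (s := {r | ∃ c ∈ D1, c ∉ D2 ∧ rkVec Fq c = r}) ⟨_, c, h1, h2, rfl⟩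
    exact (h d hd1 hd2).trans_eq hd

/-- `C1 Bᵀ = C2 Bᵀ` for every `B ∈ Fq^{μ×n}` iff `μ < d_R(C2^⊥, C1^⊥)`
(this is universal security under `μ` observations for the nested coset scheme). -/
theorem stmt6 {Fq Fqm : Type*} [Field Fq] [Field Fqm] [Algebra Fq Fqm]
    [Fintype Fq] [Fintype Fqm]
    (q m n μ : ℕ) (hq : IsPrimePow q) (hm : 0 < m) (hn : 0 < n)
    (hcq : Fintype.card Fq = q) (hcqm : Fintype.card Fqm = q ^ m)
    (C1 C2 : Submodule Fqm (Fin n → Fqm)) (hsub : C2 < C1) :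
    (∀ B : Matrix (Fin μ) (Fin n) Fq,
        Submodule.map (Matrix.mulVecLin (B.map (algebraMap Fq Fqm))) C1
          = Submodule.map (Matrix.mulVecLin (B.map (algebraMap Fq Fqm))) C2)
    ↔ μ < dRel Fq (dualCode (C2 : Set (Fin n → Fqm)) : Set (Fin n → Fqm))
        (dualCode (C1 : Set (Fin n → Fqm)) : Set (Fin n → Fqm)) := by
  have hne : ¬ (dualCode (C2 : Set (Fin n → Fqm)) : Set (Fin n → Fqm)) ⊆
      dualCode (C1 : Set (Fin n → Fqm)) := by
    intro hle
    obtain ⟨x, hx1, hx2⟩ := SetLike.exists_of_lt hsub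
    obtain ⟨y, hy, hxy⟩ := exists_mem_dualCode_sum_ne_zero C2 hx2
    exact hxy (hle hy x hx1)
  rw [lt_dRel_iff hne]
  simp only [map_mulVecLin_eq_iff_vecMul_mem_dualCode _ hsub.le, SetLike.mem_coe]
  constructor
  · intro h c h2 h1
    by_contra hlt
    obtain ⟨B, w, rfl⟩ := (rkVec_le_iff_exists_vecMul c).1 (not_lt.1 hlt)
    exact h1 (h B w h2)
  · intro h B w h2
    by_contra h1
    exact (h _ h2 h1).not_ge ((rkVec_le_iff_exists_vecMul _).2 ⟨B, w, rfl⟩)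
end

section
/- Let q be a prime power, m, α, n, ℓ ≥ 1 and t, ρ, μ ≥ 0 integers with ρ ≤ n. Let (C_S) be a coset coding scheme with message set F_{q^m}^{α×ℓ} and codeword set F_{q^m}^{α×n}. If the scheme is universally t-error and ρ-erasure-correcting and universally secure under μ observations, then ℓ + 2t + ρ + μ ≤ n. -/
open Matrix

/-- The rank over `Fq` of a matrix with entries in `Fqm`: the dimension over `Fq`
of the `Fq`-span of its columns. -/
noncomputable def rkMat (Fq : Type*) [Field Fq] {Fqm : Type*} [Field Fqm] [Algebra Fq Fqm]
    {a N : ℕ} (E : Matrix (Fin a) (Fin N) Fqm) : ℕ :=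
  Module.finrank Fq (Submodule.span Fq (Set.range fun j : Fin N => fun i : Fin a => E i j))

/-- A coset coding scheme `CS` (a disjoint family of nonempty sets of codeword matrices)
is universally `t`-error and `ρ`-erasure-correcting. -/
def UnivCorrecting (Fq : Type*) [Field Fq] {Fqm : Type*} [Field Fqm] [Algebra Fq Fqm]
    {α n ℓ : ℕ} (t ρ : ℕ)
    (CS : Matrix (Fin α) (Fin ℓ) Fqm → Set (Matrix (Fin α) (Fin n) Fqm)) : Prop :=
  ∀ N : ℕ, 1 ≤ N → ∀ A : Matrix (Fin N) (Fin n) Fq, n - ρ ≤ A.rank →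
    ∃ D : Matrix (Fin α) (Fin N) Fqm → Matrix (Fin α) (Fin ℓ) Fqm,
      ∀ S X E, X ∈ CS S → rkMat Fq E ≤ t →
        D (X * (A.map (algebraMap Fq Fqm))ᵀ + E) = S

/-- A coset coding scheme is universally secure under `μ` observations: for a uniform
message and codeword uniform on `CS S`, the distribution of `X Bᵀ` does not depend on `S`. -/
def UnivSecure (Fq : Type*) [Field Fq] {Fqm : Type*} [Field Fqm] [Algebra Fq Fqm]
    {α n ℓ : ℕ} (μ : ℕ)
    (CS : Matrix (Fin α) (Fin ℓ) Fqm → Set (Matrix (Fin α) (Fin n) Fqm)) : Prop :=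
  ∀ (B : Matrix (Fin μ) (Fin n) Fq) (S₁ S₂ : Matrix (Fin α) (Fin ℓ) Fqm)
    (W : Matrix (Fin α) (Fin μ) Fqm),
    ({X ∈ CS S₁ | X * (B.map (algebraMap Fq Fqm))ᵀ = W}).ncard * (CS S₂).ncard
      = ({X ∈ CS S₂ | X * (B.map (algebraMap Fq Fqm))ᵀ = W}).ncard * (CS S₁).ncard

/-- Preprocessing functions `EA i` (applied to the columns `C aᵢᵀ + eᵢ`) are
`t`-error-correcting with respect to the coset coding scheme `CS`. -/
def PreprocCorrecting (Fq : Type*) [Field Fq] {Fqm : Type*} [Field Fqm] [Algebra Fq Fqm]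
    {α n ℓ d : ℕ} (t : ℕ) (A : Matrix (Fin d) (Fin n) Fq) {β : Fin d → ℕ}
    (EA : ∀ i : Fin d, (Fin α → Fqm) → (Fin (β i) → Fqm))
    (CS : Matrix (Fin α) (Fin ℓ) Fqm → Set (Matrix (Fin α) (Fin n) Fqm)) : Prop :=
  ∃ D : (∀ i : Fin d, Fin (β i) → Fqm) → Matrix (Fin α) (Fin ℓ) Fqm,
    ∀ S C E, C ∈ CS S → rkMat Fq E ≤ t →
      D (fun i => EA i (fun r => (C * (A.map (algebraMap Fq Fqm))ᵀ) r i + E r i)) = S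

theorem rkMat_le_of_support {Fq Fqm : Type*} [Field Fq] [Field Fqm] [Algebra Fq Fqm]
    {a N : ℕ} (E : Matrix (Fin a) (Fin N) Fqm) (b t : ℕ)
    (h : ∀ i (j : Fin N), E i j ≠ 0 → b ≤ j.val ∧ j.val < b + t) : rkMat Fq E ≤ t := by
  classical
  set J : Finset (Fin N) := Finset.univ.filter fun j => b ≤ j.val ∧ j.val < b + t
  have hJ : J.card ≤ t := by
    calc J.card = (J.image Fin.val).card := (Finset.card_image_of_injective _ Fin.val_injective).symm
      _ ≤ (Finset.Ico b (b + t)).card := Finset.card_le_card fun x hx => by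
          simp only [J, Finset.mem_image, Finset.mem_filter] at hx
          obtain ⟨j, ⟨-, hj⟩, rfl⟩ := hx
          exact Finset.mem_Ico.2 hj
      _ = t := by simp
  have hspan : Submodule.span Fq (Set.range fun j : Fin N => fun i : Fin a => E i j) ≤
      Submodule.span Fq ((J.image fun j => fun i : Fin a => E i j : Finset (Fin a → Fqm)) :
        Set (Fin a → Fqm)) := by
    rw [Submodule.span_le]
    rintro _ ⟨j, rfl⟩
    by_cases hj : j ∈ J
    · exact Submodule.subset_span (Finset.mem_coe.2 (Finset.mem_image_of_mem _ hj))
    · have h0 : (fun i : Fin a => E i j) = 0 := by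
        funext i
        by_contra hi
        exact hj (Finset.mem_filter.2 ⟨Finset.mem_univ _, h i j hi⟩)
      simp only [h0]
      exact Submodule.zero_mem _
  exact (Submodule.finrank_mono hspan).trans
    ((finrank_span_finset_le_card _).trans (Finset.card_image_le.trans hJ))

/-- In a universally correcting scheme, codewords that differ in at most `2 * t + ρ` final
columns encode the same message. -/
theorem UnivCorrecting.eq_of_agree {Fq Fqm : Type*} [Field Fq] [Field Fqm] [Algebra Fq Fqm]
    {α n ℓ t ρ b : ℕ} {CS : Matrix (Fin α) (Fin ℓ) Fqm → Set (Matrix (Fin α) (Fin n) Fqm)}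
    (hcorr : UnivCorrecting Fq t ρ CS) (hn : 0 < n) (hb : n ≤ b + 2 * t + ρ)
    {S T : Matrix (Fin α) (Fin ℓ) Fqm} {X Y : Matrix (Fin α) (Fin n) Fqm}
    (hX : X ∈ CS S) (hY : Y ∈ CS T) (h : ∀ i (j : Fin n), j.val < b → X i j = Y i j) :
    S = T := by
  classical
  set w : Fin n → Fq := fun j => if j.val < n - ρ then 1 else 0 with hw
  have hrank : n - ρ ≤ (Matrix.diagonal w).rank := by
    rw [Matrix.rank_diagonal]
    calc n - ρ = Fintype.card (Fin (n - ρ)) := by simp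
      _ ≤ _ := Fintype.card_le_of_injective
          (fun k => ⟨⟨k.val, by omega⟩, by simp [hw]⟩)
          (fun k l hkl => Fin.ext (congrArg (fun x => x.1.val) hkl))
  obtain ⟨D, hD⟩ := hcorr n hn _ hrank
  have hmul : ∀ (Z : Matrix (Fin α) (Fin n) Fqm) i j,
      (Z * ((Matrix.diagonal w).map (algebraMap Fq Fqm))ᵀ) i j =
        if j.val < n - ρ then Z i j else 0 := by
    intro Z i j
    rw [Matrix.diagonal_map (map_zero _), Matrix.diagonal_transpose, Matrix.mul_diagonal]
    simp only [hw]
    split_ifs <;> simp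
  set E₁ : Matrix (Fin α) (Fin n) Fqm := Matrix.of fun i j =>
    if b ≤ j.val ∧ j.val < b + t ∧ j.val < n - ρ then Y i j - X i j else 0 with hE₁
  set E₂ : Matrix (Fin α) (Fin n) Fqm := Matrix.of fun i j =>
    if b + t ≤ j.val ∧ j.val < n - ρ then X i j - Y i j else 0 with hE₂
  have h₁ : rkMat Fq E₁ ≤ t := by
    refine rkMat_le_of_support E₁ b t fun i j hij => ?_
    by_contra hc
    exact hij (if_neg fun hj => hc ⟨hj.1, hj.2.1⟩)
  have h₂ : rkMat Fq E₂ ≤ t := by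
    refine rkMat_le_of_support E₂ (b + t) t fun i j hij => ?_
    by_contra hc
    exact hij (if_neg fun hj => hc ⟨hj.1, by omega⟩)
  rw [← hD S X E₁ hX h₁, ← hD T Y E₂ hY h₂]
  congr 1
  ext i j
  rw [Matrix.add_apply, Matrix.add_apply, hmul, hmul]
  simp only [hE₁, hE₂, Matrix.of_apply]
  rcases lt_or_ge j.val b with hj | hj
  · simp [h i j hj]
  · split_ifs <;> first | omega | ring

/-- In a universally secure scheme, an observation possible for one message is possible for
every message. -/
theorem UnivSecure.exists_mem_mul_eq {Fq Fqm : Type*} [Field Fq] [Field Fqm] [Algebra Fq Fqm]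
    [Finite Fqm] {α n ℓ μ : ℕ}
    {CS : Matrix (Fin α) (Fin ℓ) Fqm → Set (Matrix (Fin α) (Fin n) Fqm)}
    (hsec : UnivSecure Fq μ CS) (hne : ∀ S, (CS S).Nonempty) (B : Matrix (Fin μ) (Fin n) Fq)
    {S₀ : Matrix (Fin α) (Fin ℓ) Fqm} {X₀ : Matrix (Fin α) (Fin n) Fqm} (hX₀ : X₀ ∈ CS S₀)
    (S : Matrix (Fin α) (Fin ℓ) Fqm) :
    ∃ X ∈ CS S, X * (B.map (algebraMap Fq Fqm))ᵀ = X₀ * (B.map (algebraMap Fq Fqm))ᵀ := by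
  have hfin : ∀ s : Set (Matrix (Fin α) (Fin n) Fqm), s.Finite := fun s =>
    have : Finite (Matrix (Fin α) (Fin n) Fqm) :=
      inferInstanceAs (Finite (Fin α → Fin n → Fqm))
    Set.toFinite s
  have key := hsec B S S₀ (X₀ * (B.map (algebraMap Fq Fqm))ᵀ)
  have hpos := Nat.mul_pos
    ((Set.ncard_pos (hfin {X ∈ CS S₀ | X * (B.map (algebraMap Fq Fqm))ᵀ =
      X₀ * (B.map (algebraMap Fq Fqm))ᵀ})).2 ⟨X₀, hX₀, rfl⟩)
    ((Set.ncard_pos (hfin (CS S))).2 (hne S))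
  rw [← key] at hpos
  obtain ⟨X, hX, hXW⟩ := (Set.ncard_pos (hfin _)).1 (Nat.pos_of_mul_pos_right hpos)
  exact ⟨X, hX, hXW⟩

/-- the information-rate bound `ℓ + 2t + ρ + μ ≤ n`. -/
theorem stmt7 {Fq Fqm : Type*} [Field Fq] [Field Fqm] [Algebra Fq Fqm]
    [Fintype Fq] [Fintype Fqm]
    (q m α n ℓ t ρ μ : ℕ) (hq : IsPrimePow q)
    (hm : 0 < m) (hα : 0 < α) (hn : 0 < n) (hℓ : 0 < ℓ) (hρn : ρ ≤ n)
    (hcq : Fintype.card Fq = q) (hcqm : Fintype.card Fqm = q ^ m)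
    (CS : Matrix (Fin α) (Fin ℓ) Fqm → Set (Matrix (Fin α) (Fin n) Fqm))
    (hne : ∀ S, (CS S).Nonempty)
    (hdisj : ∀ S T, S ≠ T → Disjoint (CS S) (CS T))
    (hcorr : UnivCorrecting Fq t ρ CS)
    (hsec : UnivSecure Fq μ CS) :
    ℓ + 2 * t + ρ + μ ≤ n := by
  classical
  set B : Matrix (Fin μ) (Fin n) Fq := Matrix.of fun i j => if i.val = j.val then 1 else 0 with hB
  have hmul : ∀ (Z : Matrix (Fin α) (Fin n) Fqm) i (k : Fin μ) (j : Fin n), k.val = j.val →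
      (Z * (B.map (algebraMap Fq Fqm))ᵀ) i k = Z i j := by
    intro Z i k j hkj
    rw [Matrix.mul_apply, Finset.sum_eq_single j]
    · simp [hB, hkj]
    · intro c _ hc
      have : k.val ≠ c.val := fun h => hc (Fin.ext (h.symm.trans hkj))
      simp [hB, this]
    · simp
  obtain ⟨X₀, hX₀⟩ := hne 0
  choose X hX hXB using hsec.exists_mem_mul_eq hne B hX₀
  have hobs : ∀ S T i (j : Fin n), j.val < μ → X S i j = X T i j := by
    intro S T i j hj
    rw [← hmul (X S) i ⟨j, hj⟩ j rfl, ← hmul (X T) i ⟨j, hj⟩ j rfl, hXB S, hXB T]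
  set d := n - μ - 2 * t - ρ with hd
  let f : (Fin α → Fin ℓ → Fqm) → (Fin α → Fin d → Fqm) := fun S i k =>
    X S i ⟨μ + k.val, by omega⟩
  have hf : Function.Injective f := by
    intro S T hST
    refine hcorr.eq_of_agree (b := μ + d) hn (by omega) (hX S) (hX T) fun i j hj => ?_
    rcases lt_or_ge j.val μ with hjμ | hjμ
    · exact hobs S T i j hjμ
    · have := congrFun (congrFun hST i) ⟨j.val - μ, by omega⟩
      simpa only [f, Nat.add_sub_cancel' hjμ] using this
  have hcard := Fintype.card_le_of_injective f hf
  simp only [Fintype.card_fun, Fintype.card_fin, ← pow_mul] at hcard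
  have hle : ℓ * α ≤ d * α := (Nat.pow_le_pow_iff_right Fintype.one_lt_card).1 hcard
  have := Nat.le_of_mul_le_mul_right hle hα
  omega
end

section
/- Let q be a prime power, m, α, n, ℓ, d ≥ 1 and t, μ ≥ 0 integers with 2t + μ < d. Let (C_S) be a coset coding scheme with message set F_{q^m}^{α×ℓ} and codeword set F_{q^m}^{α×n} that is universally secure under μ observations. Let A ∈ F_q^{d×n} have rank d, and let E_{A,i} : F_{q^m}^α → F_{q^m}^{β_i} (i = 1,…,d) be preprocessing functions that are t-error-correcting with respect to the scheme. Then (Σ_{i=1}^d β_i) · (d − 2t − μ) ≥ α · ℓ · d; equivalently, the communication overhead satisfies CO(A) = (Σ_{i=1}^d β_i)/α − ℓ ≥ ℓ(2t + μ)/(d − 2t − μ). -/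
open Matrix

/-- A matrix whose nonzero columns are indexed by `T` has rank at most `#T`. -/
theorem rkMat_le_card_of_support (Fq : Type*) [Field Fq] {Fqm : Type*} [Field Fqm] [Algebra Fq Fqm]
    {a N : ℕ} (E : Matrix (Fin a) (Fin N) Fqm) (T : Finset (Fin N))
    (hE : ∀ j ∉ T, ∀ i, E i j = 0) : rkMat Fq E ≤ T.card := by
  classical
  set c : Fin N → (Fin a → Fqm) := fun j i => E i j with hc
  have hle : Submodule.span Fq (Set.range c) ≤
      Submodule.span Fq ((T.image c : Finset (Fin a → Fqm)) : Set (Fin a → Fqm)) := by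
    rw [Submodule.span_le]
    rintro _ ⟨j, rfl⟩
    by_cases hj : j ∈ T
    · exact Submodule.subset_span (by simpa using ⟨j, hj, rfl⟩)
    · have : c j = 0 := funext fun i => hE j hj i
      rw [this]
      exact Submodule.zero_mem _
  have hfin : Module.Finite Fq
      (Submodule.span Fq ((T.image c : Finset (Fin a → Fqm)) : Set (Fin a → Fqm))) :=
    FiniteDimensional.span_finset Fq _
  exact (Submodule.finrank_mono hle).trans
    ((finrank_span_finset_le_card _).trans Finset.card_image_le)

/-- If two codewords have the same preprocessed columns outside of two disjoint sets of at
most `t` columns, then they encode the same message. -/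
theorem PreprocCorrecting.message_eq {Fq Fqm : Type*} [Field Fq] [Field Fqm] [Algebra Fq Fqm]
    {α n ℓ d t : ℕ} {A : Matrix (Fin d) (Fin n) Fq} {β : Fin d → ℕ}
    {EA : ∀ i : Fin d, (Fin α → Fqm) → (Fin (β i) → Fqm)}
    {CS : Matrix (Fin α) (Fin ℓ) Fqm → Set (Matrix (Fin α) (Fin n) Fqm)}
    (h : PreprocCorrecting Fq t A EA CS) {T₁ T₂ : Finset (Fin d)}
    (h₁ : T₁.card ≤ t) (h₂ : T₂.card ≤ t) (hT : Disjoint T₁ T₂)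
    {S S' : Matrix (Fin α) (Fin ℓ) Fqm} {C C' : Matrix (Fin α) (Fin n) Fqm}
    (hC : C ∈ CS S) (hC' : C' ∈ CS S')
    (heq : ∀ i, i ∉ T₁ → i ∉ T₂ →
      EA i (fun r => (C * (A.map (algebraMap Fq Fqm))ᵀ) r i) =
        EA i (fun r => (C' * (A.map (algebraMap Fq Fqm))ᵀ) r i)) : S = S' := by
  obtain ⟨D, hD⟩ := h
  set X := C * (A.map (algebraMap Fq Fqm))ᵀ with hX
  set X' := C' * (A.map (algebraMap Fq Fqm))ᵀ with hX'
  have e₁ := hD S C (fun r i => if i ∈ T₁ then X' r i - X r i else 0) hC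
    ((rkMat_le_card_of_support Fq _ T₁ fun j hj i => if_neg hj).trans h₁)
  have e₂ := hD S' C' (fun r i => if i ∈ T₂ then X r i - X' r i else 0) hC'
    ((rkMat_le_card_of_support Fq _ T₂ fun j hj i => if_neg hj).trans h₂)
  rw [← e₁, ← e₂]
  congr 1
  funext i
  by_cases hi₁ : i ∈ T₁
  · have hi₂ : i ∉ T₂ := Finset.disjoint_left.mp hT hi₁
    simp [hi₁, hi₂, ← hX, ← hX']
  · by_cases hi₂ : i ∈ T₂
    · simp [hi₁, hi₂, ← hX, ← hX']
    · simpa [hi₁, hi₂] using heq i hi₁ hi₂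

/-- In a universally secure scheme, some observation is compatible with every message. -/
theorem UnivSecure.exists_common_observation {Fq Fqm : Type*} [Field Fq] [Field Fqm]
    [Algebra Fq Fqm] [Finite Fqm] {α n ℓ μ : ℕ}
    {CS : Matrix (Fin α) (Fin ℓ) Fqm → Set (Matrix (Fin α) (Fin n) Fqm)}
    (h : UnivSecure Fq μ CS) (hne : ∀ S, (CS S).Nonempty) (B : Matrix (Fin μ) (Fin n) Fq) :
    ∃ W, ∀ S, ∃ X ∈ CS S, X * (B.map (algebraMap Fq Fqm))ᵀ = W := by
  obtain ⟨X₀, hX₀⟩ := hne 0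
  have : Finite (Matrix (Fin α) (Fin n) Fqm) := inferInstanceAs (Finite (Fin α → Fin n → Fqm))
  refine ⟨X₀ * (B.map (algebraMap Fq Fqm))ᵀ, fun S => ?_⟩
  have hsec := h B 0 S (X₀ * (B.map (algebraMap Fq Fqm))ᵀ)
  have hpos : 0 < ({X ∈ CS 0 | X * (B.map (algebraMap Fq Fqm))ᵀ =
      X₀ * (B.map (algebraMap Fq Fqm))ᵀ}).ncard * (CS S).ncard :=
    Nat.mul_pos ((Set.ncard_pos (Set.toFinite _)).mpr ⟨X₀, hX₀, rfl⟩)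
      ((Set.ncard_pos (Set.toFinite _)).mpr (hne S))
  rw [hsec] at hpos
  obtain ⟨X, hX, hXW⟩ := (Set.ncard_pos (Set.toFinite _)).mp (Nat.pos_of_mul_pos_right hpos)
  exact ⟨X, hX, hXW⟩

/-- Any `d - 2t - μ` preprocessed columns must carry at least as many symbols as a message. -/
theorem PreprocCorrecting.mul_le_sum {Fq Fqm : Type*} [Field Fq] [Field Fqm] [Algebra Fq Fqm]
    [Fintype Fqm] {α n ℓ d t μ : ℕ} {A : Matrix (Fin d) (Fin n) Fq} {β : Fin d → ℕ}
    {EA : ∀ i : Fin d, (Fin α → Fqm) → (Fin (β i) → Fqm)}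
    {CS : Matrix (Fin α) (Fin ℓ) Fqm → Set (Matrix (Fin α) (Fin n) Fqm)}
    (h : PreprocCorrecting Fq t A EA CS) (hsec : UnivSecure Fq μ CS)
    (hne : ∀ S, (CS S).Nonempty) (J : Finset (Fin d)) (hJ : J.card + (2 * t + μ) = d) :
    α * ℓ ≤ ∑ j ∈ J, β j := by
  classical
  have hJc : Jᶜ.card = 2 * t + μ := by
    rw [Finset.card_compl, Fintype.card_fin]
    omega
  obtain ⟨I, hIJ, hI⟩ := Finset.exists_subset_card_eq (s := Jᶜ) (n := μ) (by omega)
  have hR : (Jᶜ \ I).card = 2 * t := by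
    rw [Finset.card_sdiff_of_subset hIJ]
    omega
  obtain ⟨T₁, hT₁, hT₁c⟩ := Finset.exists_subset_card_eq (s := Jᶜ \ I) (n := t) (by omega)
  have hT₂c : ((Jᶜ \ I) \ T₁).card = t := by
    rw [Finset.card_sdiff_of_subset hT₁]
    omega
  let e : Fin μ ≃ I := (I.equivFinOfCardEq hI).symm
  obtain ⟨W, hW⟩ := hsec.exists_common_observation hne (A.submatrix (fun k => (e k : Fin d)) id)
  choose X hXS hXW using hW
  let f : Matrix (Fin α) (Fin ℓ) Fqm → ∀ j : J, Fin (β j) → Fqm := fun S j =>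
    EA j (fun r => (X S * (A.map (algebraMap Fq Fqm))ᵀ) r j)
  have hf : Function.Injective f := by
    intro S S' hSS'
    refine h.message_eq hT₁c.le hT₂c.le Finset.disjoint_sdiff (hXS S) (hXS S') ?_
    intro i hi₁ hi₂
    by_cases hiJ : i ∈ J
    · exact congrFun hSS' ⟨i, hiJ⟩
    · have hiI : i ∈ I := by
        by_contra hiI
        exact hi₂ (by simp [hiJ, hiI, hi₁])
      congr 1
      funext r
      have hcol := congrFun (congrFun ((hXW S).trans (hXW S').symm) r) (e.symm ⟨i, hiI⟩)
      simpa [Matrix.mul_apply] using hcol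
  have hcard : Nat.card (Fin α → Fin ℓ → Fqm) ≤ Nat.card (∀ j : J, Fin (β j) → Fqm) :=
    Nat.card_le_card_of_injective f hf
  have hlhs : Nat.card (Fin α → Fin ℓ → Fqm) = Nat.card Fqm ^ (α * ℓ) := by
    simp [← pow_mul, mul_comm]
  have hrhs : Nat.card (∀ j : J, Fin (β j) → Fqm) = Nat.card Fqm ^ (∑ j ∈ J, β j) := by
    rw [Nat.card_pi]
    simp only [Nat.card_fun, Nat.card_fin]
    rw [Finset.prod_pow_eq_pow_sum, Finset.univ_eq_attach, Finset.sum_attach J β]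
  rw [hlhs, hrhs] at hcard
  exact (Nat.pow_le_pow_iff_right Finite.one_lt_card).mp hcard

/-- If `a` is a lower bound for the sum of `f` over all sets of size `k`, then `a / k` is a
lower bound for the average of `f`. -/
theorem mul_card_le_sum_mul_of_forall_card_eq {d k a : ℕ} (f : Fin d → ℕ) (hk : k ≤ d)
    (h : ∀ J : Finset (Fin d), J.card = k → a ≤ ∑ j ∈ J, f j) : a * d ≤ (∑ i, f i) * k := by
  obtain rfl | hd := Nat.eq_zero_or_pos d
  · simp
  have : NeZero d := ⟨hd.ne'⟩
  obtain ⟨K, -, hK⟩ := Finset.exists_subset_card_eq (s := (Finset.univ : Finset (Fin d))) (n := k)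
    (by simpa using hk)
  calc a * d = ∑ _s : Fin d, a := by simp [mul_comm]
    _ ≤ ∑ s : Fin d, ∑ j ∈ K, f (s + j) := by
        refine Finset.sum_le_sum fun s _ => ?_
        have := h (K.map (Equiv.addLeft s).toEmbedding) (by simpa using hK)
        simpa using this
    _ = ∑ j ∈ K, ∑ s : Fin d, f (s + j) := Finset.sum_comm
    _ = ∑ j ∈ K, ∑ i, f i :=
        Finset.sum_congr rfl fun j _ => Equiv.sum_comp (Equiv.addRight j) f
    _ = (∑ i, f i) * k := by simp [hK, mul_comm]

/-- the communication-overhead lower bound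
`(∑ i, β i) * (d - 2t - μ) ≥ α * ℓ * d`, i.e. `CO(A) ≥ ℓ(2t+μ)/(d-2t-μ)`. -/
theorem stmt8 {Fq Fqm : Type*} [Field Fq] [Field Fqm] [Algebra Fq Fqm]
    [Fintype Fq] [Fintype Fqm]
    (q m α n ℓ d t μ : ℕ) (hq : IsPrimePow q)
    (hm : 0 < m) (hα : 0 < α) (hn : 0 < n) (hℓ : 0 < ℓ) (hd : 0 < d)
    (htμ : 2 * t + μ < d)
    (hcq : Fintype.card Fq = q) (hcqm : Fintype.card Fqm = q ^ m)
    (CS : Matrix (Fin α) (Fin ℓ) Fqm → Set (Matrix (Fin α) (Fin n) Fqm))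
    (hne : ∀ S, (CS S).Nonempty)
    (hdisj : ∀ S T, S ≠ T → Disjoint (CS S) (CS T))
    (hsec : UnivSecure Fq μ CS)
    (A : Matrix (Fin d) (Fin n) Fq) (hA : A.rank = d)
    (β : Fin d → ℕ) (hβ : ∀ i, 1 ≤ β i)
    (EA : ∀ i : Fin d, (Fin α → Fqm) → (Fin (β i) → Fqm))
    (hEA : PreprocCorrecting Fq t A EA CS) :
    α * ℓ * d ≤ (∑ i, β i) * (d - 2 * t - μ) := by
  exact mul_card_le_sum_mul_of_forall_card_eq β (by omega) fun J hJ =>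
    hEA.mul_le_sum hsec hne J (by omega)
end

section
/- Let q be a prime power and n ≤ m positive integers. Let 0 ≤ k_2 < k_1 ≤ n and t_0, ρ_0 ≥ 0 be integers with 2t_0 + ρ_0 = n − k_1, and set ℓ = k_1 − k_2. Let n − ρ_0 = d_h < d_{h−1} < … < d_1 ≤ n be integers and set α = lcm(d_1 − 2t_0 − k_2, …, d_h − 2t_0 − k_2). Then there exists a coset coding scheme (C_S) with message set F_{q^m}^{α×ℓ} and codeword set F_{q^m}^{α×n} such that: (1) for all integers t, ρ ≥ 0 with 2t + ρ ≤ n − k_1, the scheme is universally t-error and ρ-erasure-correcting; (2) for every integer μ with 0 ≤ μ ≤ k_2, the scheme is universally secure under μ observations (so ℓ = n − 2t − ρ − μ attains the information-rate bound for t, ρ, μ with 2t + ρ = n − k_1 and μ = k_2); (3) for every j ∈ {1,…,h} and every full-rank A ∈ F_q^{d_j×n} there exist preprocessing functions E_{A,i} : F_{q^m}^α → F_{q^m}^{ℓα/(d_j − 2t_0 − k_2)} (i = 1,…,d_j) that are t_0-error-correcting with respect to the scheme; in particular CO(A) = ℓ(2t_0 + k_2)/(d_j − 2t_0 − k_2),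 which attains the communication-overhead lower bound with equality. -/
open Matrix

/-- If `t` has at most as many elements as `s`, some function maps a part of `s` onto `t`. -/
theorem exists_fun_covering {X Y : Type*} [Nonempty Y] (s : Finset X) (t : Finset Y)
    (hst : t.card ≤ s.card) : ∃ f : X → Y, ∀ y ∈ t, ∃ x ∈ s, f x = y := by
  classical
  obtain ⟨g⟩ : Nonempty (t ↪ s) := Function.Embedding.nonempty_of_card_le (by simpa using hst)
  refine ⟨fun x => if h : ∃ y : t, (g y : X) = x then h.choose else Classical.arbitrary Y,
    fun y hy => ⟨g ⟨y, hy⟩, (g ⟨y, hy⟩).2, ?_⟩⟩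
  have h : ∃ y' : t, (g y' : X) = g ⟨y, hy⟩ := ⟨⟨y, hy⟩, rfl⟩
  have h2 := g.injective (Subtype.ext h.choose_spec)
  simp only [dif_pos h, h2]

/-- The staircase arrangement of the message symbols `ι` (with `none` standing for a zero entry):
if every row `r < b j` vanishes as soon as it vanishes beyond column `a j`, then the message
is zero. -/
theorem exists_staircase {ι K : Type*} [Fintype ι] [Nonempty ι] [Zero K] (a b : ℕ → ℕ)
    (ha : Antitone a) (hb : Monotone b) (hab : ∀ j, b j * a j = Fintype.card ι) (J : ℕ) :
    ∃ m : ℕ → ℕ → Option ι, (∀ r i, a 0 ≤ i → m r i = none) ∧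
      ∀ S : ι → K, ∀ j ≤ J,
        (∀ r < b j, (∀ i, a j ≤ i → (m r i).elim 0 S = 0) → ∀ i, (m r i).elim 0 S = 0) →
        ∀ x, S x = 0 := by
  induction J with
  | zero =>
    obtain ⟨f, hf⟩ := exists_fun_covering (Finset.range (b 0) ×ˢ Finset.range (a 0))
      (Finset.univ : Finset ι) (by simp [hab])
    refine ⟨fun r i => if i < a 0 then some (f (r, i)) else none,
      fun r i hi => if_neg (by omega), fun S j hj h x => ?_⟩
    obtain rfl : j = 0 := by omega
    obtain ⟨⟨r, i⟩, hp, hx⟩ := hf x (Finset.mem_univ x)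
    simp only [Finset.mem_product, Finset.mem_range] at hp
    have := h r hp.1 (fun i hi => by simp [show ¬ i < a 0 by omega]) i
    simpa [hp.2, hx] using this
  | succ J ih =>
    obtain ⟨m, hm0, hm⟩ := ih
    obtain ⟨f, hf⟩ := exists_fun_covering
      (Finset.Ico (b J) (b (J + 1)) ×ˢ Finset.range (a (J + 1)))
      (Finset.range (b J) ×ˢ Finset.Ico (a (J + 1)) (a J)) (by
        simp only [Finset.card_product, Finset.card_range, Nat.card_Ico]
        rw [Nat.mul_sub, Nat.sub_mul, hab, hab])
    have hbJ : b J ≤ b (J + 1) := hb (Nat.le_succ J)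
    refine ⟨fun r i => if r < b J then m r i else
      if i < a (J + 1) then m (f (r, i)).1 (f (r, i)).2 else none, fun r i hi => ?_,
      fun S j hj h x => ?_⟩
    · have := ha (Nat.zero_le (J + 1))
      simp only [hm0 r i hi, show ¬ i < a (J + 1) by omega, if_false, ite_self]
    · rcases Nat.lt_or_ge J j with hJ | hJ
      · obtain rfl : j = J + 1 := by omega
        have hD : ∀ r < b J, ∀ i, a (J + 1) ≤ i → i < a J → (m r i).elim 0 S = 0 := by
          intro r hr i hi hi'
          obtain ⟨⟨r', i'⟩, hp, hx⟩ := hf (r, i) (by simp [hr, hi, hi'])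
          simp only [Finset.mem_product, Finset.mem_range, Finset.mem_Ico] at hp
          have := h r' hp.1.2 (fun i hi => by
            simp [show ¬ r' < b J by omega, show ¬ i < a (J + 1) by omega]) i'
          simpa [show ¬ r' < b J by omega, hp.2, hx] using this
        refine hm S J le_rfl (fun r hr hz i => ?_) x
        have := h r (by omega) (fun i hi => ?_) i
        · simpa [hr] using this
        · rcases Nat.lt_or_ge i (a J) with h' | h'
          · simpa [hr] using hD r hr i hi h'
          · simpa [hr] using hz i h'
      · have hbj := hb hJ
        refine hm S j hJ (fun r hr hz i => ?_) x
        have := h r hr (fun i hi => ?_) i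
        · simpa [show r < b J by omega] using this
        · simpa [show r < b J by omega] using hz i hi

theorem rkVec_sub_le_s11 {Fq Fqm : Type*} [Field Fq] [Field Fqm] [Algebra Fq Fqm]
    {a N : ℕ} [Finite Fqm] (E₁ E₂ : Matrix (Fin a) (Fin N) Fqm)
    (r : Fin a) :
    rkVec Fq (E₁ r - E₂ r) ≤ rkMat Fq E₁ + rkMat Fq E₂ := by
  have hrow : ∀ E : Matrix (Fin a) (Fin N) Fqm,
      Module.finrank Fq (Submodule.span Fq (Set.range (E r))) ≤ rkMat Fq E := by
    intro E
    have : Submodule.span Fq (Set.range (E r)) = (Submodule.span Fq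
        (Set.range fun j : Fin N => fun i : Fin a => E i j)).map (LinearMap.proj r) := by
      rw [Submodule.map_span, ← Set.range_comp]
      rfl
    rw [this]
    exact Submodule.finrank_map_le _ _
  refine le_trans ?_ (Nat.add_le_add (hrow E₁) (hrow E₂))
  refine le_trans (Submodule.finrank_mono ?_) (Submodule.finrank_add_le_finrank_add_finrank _ _)
  rw [Submodule.span_le]
  rintro _ ⟨j, rfl⟩
  exact Submodule.sub_mem _
    (Submodule.mem_sup_left (Submodule.subset_span ⟨j, rfl⟩))
    (Submodule.mem_sup_right (Submodule.subset_span ⟨j, rfl⟩))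

theorem rank_map_algebraMap_le {Fq Fqm : Type*} [Field Fq] [Field Fqm] [Algebra Fq Fqm]
    {n μ : ℕ} (B : Matrix (Fin μ) (Fin n) Fq) :
    (B.map (algebraMap Fq Fqm)).rank ≤ B.rank := by
  rw [Matrix.rank_eq_finrank_span_row, Matrix.rank_eq_finrank_span_row]
  let b := Module.finBasis Fq (Submodule.span Fq (Set.range B.row))
  let f : (Fin n → Fq) →ₗ[Fq] (Fin n → Fqm) := (Algebra.linearMap Fq Fqm).compLeft (Fin n)
  let w := fun i => f (b i)
  have hle : Submodule.span Fqm (Set.range (B.map (algebraMap Fq Fqm)).row) ≤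
      Submodule.span Fqm (Set.range w) := by
    rw [Submodule.span_le]
    rintro _ ⟨a, rfl⟩
    let y : Submodule.span Fq (Set.range B.row) := ⟨B.row a, Submodule.subset_span ⟨a, rfl⟩⟩
    have hy : (B.map (algebraMap Fq Fqm)).row a = ∑ i, b.repr y i • w i := by
      have h := congrArg (fun z : Submodule.span Fq (Set.range B.row) => f z) (b.sum_repr y)
      simp only [Submodule.coe_sum, Submodule.coe_smul, map_sum, map_smul] at h
      exact h.symm
    rw [hy]
    refine Submodule.sum_mem _ fun i _ => ?_
    rw [← algebraMap_smul Fqm]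
    exact Submodule.smul_mem _ _ (Submodule.subset_span ⟨i, rfl⟩)
  refine (Submodule.finrank_mono hle).trans ?_
  simpa [Set.finrank] using finrank_range_le_card (R := Fqm) w

section Gabidulin

variable {Fq Fqm : Type*} [Field Fq] [Field Fqm] [Algebra Fq Fqm] [Fintype Fq] {n : ℕ}

/-- The linearized polynomial `y ↦ ∑ i, c i * y ^ q ^ i` as an `Fq`-linear map. -/
noncomputable def linPoly (Fq : Type*) {Fqm : Type*} [Field Fq] [Field Fqm] [Algebra Fq Fqm]
    [Fintype Fq] {n : ℕ} (c : Fin n → Fqm) : Fqm →ₗ[Fq] Fqm :=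
  ∑ i, c i • ((FiniteField.frobeniusAlgHom Fq Fqm) ^ (i : ℕ)).toLinearMap

theorem linPoly_apply (c : Fin n → Fqm) (y : Fqm) :
    linPoly Fq c y = ∑ i, c i * y ^ Fintype.card Fq ^ (i : ℕ) := by
  simp [linPoly, LinearMap.sum_apply, AlgHom.coe_pow, FiniteField.coe_frobeniusAlgHom, pow_iterate]

theorem finrank_ker_linPoly_lt [Finite Fqm] {c : Fin n → Fqm} (hc : c ≠ 0) {k : ℕ}
    (hk : ∀ i : Fin n, k ≤ i → c i = 0) : Module.finrank Fq (LinearMap.ker (linPoly Fq c)) < k := by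
  classical
  have := Fintype.ofFinite Fqm
  obtain ⟨i₀, hi₀⟩ := Function.ne_iff.mp hc
  have hi₀k : (i₀ : ℕ) < k := by
    by_contra h
    exact hi₀ (hk i₀ (by omega))
  have hq : 1 < Fintype.card Fq := Fintype.one_lt_card
  let P : Polynomial Fqm :=
    ∑ i : Fin n, Polynomial.C (c i) * Polynomial.X ^ Fintype.card Fq ^ (i : ℕ)
  have hP : P ≠ 0 := by
    intro h
    have h1 : P.coeff (Fintype.card Fq ^ (i₀ : ℕ)) = c i₀ := by
      simp only [P, Polynomial.finsetSum_coeff, Polynomial.coeff_C_mul_X_pow]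
      rw [Finset.sum_eq_single i₀]
      · simp
      · intro i _ hi
        rw [if_neg]
        intro h2
        exact hi (Fin.ext (Nat.pow_right_injective hq h2).symm)
      · simp
    exact hi₀ (by simpa [h] using h1.symm)
  have hdeg : P.natDegree ≤ Fintype.card Fq ^ (k - 1) := by
    refine Polynomial.natDegree_sum_le_of_forall_le _ _ fun i _ => ?_
    by_cases hi : k ≤ i
    · simp [hk i hi]
    · exact (Polynomial.natDegree_C_mul_X_pow_le _ _).trans
        (Nat.pow_le_pow_right hq.le (by omega))
  have hcard : Fintype.card (LinearMap.ker (linPoly Fq c)) ≤ P.natDegree := by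
    refine le_trans ?_ ((Multiset.toFinset_card_le _).trans (Polynomial.card_roots' P))
    rw [← Fintype.card_coe]
    refine Fintype.card_le_of_injective
      (fun y => ⟨y.1, ?_⟩) (fun y z h => Subtype.ext (by simpa using h))
    have hy := y.2
    rw [LinearMap.mem_ker, linPoly_apply] at hy
    simp [hP, P, Polynomial.IsRoot, Polynomial.eval_finsetSum, hy]
  rw [Module.card_eq_pow_finrank (K := Fq)] at hcard
  have := (Nat.pow_le_pow_iff_right hq).mp (hcard.trans hdeg)
  omega

/-- The Moore matrix with rows `g ^ q ^ i`, whose first `k` rows generate the Gabidulin code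
of dimension `k`. -/
def moore (Fq : Type*) [Fintype Fq] {Fqm : Type*} [Field Fqm] {n : ℕ} (g : Fin n → Fqm) :
    Matrix (Fin n) (Fin n) Fqm :=
  Matrix.of fun i j => g j ^ Fintype.card Fq ^ (i : ℕ)

theorem vecMul_moore (g c : Fin n → Fqm) (j : Fin n) :
    (c ᵥ* moore Fq g) j = linPoly Fq c (g j) := by
  simp [linPoly_apply, Matrix.vecMul, dotProduct, moore]

/-- Gabidulin codes are MRD: a nonzero codeword with coefficients supported on the first `k`
powers, seen through a matrix `A`, has rank weight larger than `A.rank - k`. -/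
theorem eq_zero_of_rkVec_add_le [Finite Fqm] {g : Fin n → Fqm} (hg : LinearIndependent Fq g)
    {N k : ℕ} (A : Matrix (Fin N) (Fin n) Fq) {c : Fin n → Fqm}
    (hk : ∀ i : Fin n, k ≤ i → c i = 0)
    (h : rkVec Fq (A.map (algebraMap Fq Fqm) *ᵥ (c ᵥ* moore Fq g)) + k ≤ A.rank) : c = 0 := by
  by_contra hc
  have hker := finrank_ker_linPoly_lt (Fq := Fq) hc hk
  let φ : (Fin n → Fq) →ₗ[Fq] Fqm := Fintype.linearCombination Fq g
  have hφ : Function.Injective φ := hg.fintypeLinearCombination_injective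
  let U := (Submodule.span Fq (Set.range A.row)).map φ
  have hU : Module.finrank Fq U = A.rank := by
    rw [Matrix.rank_eq_finrank_span_row]
    exact (Submodule.equivMapOfInjective φ hφ _).finrank_eq.symm
  have hmap : U.map (linPoly Fq c) = Submodule.span Fq
      (Set.range (A.map (algebraMap Fq Fqm) *ᵥ (c ᵥ* moore Fq g))) := by
    simp only [U]
    rw [Submodule.map_span, Submodule.map_span, ← Set.range_comp, ← Set.range_comp]
    congr 2
    ext a
    change linPoly Fq c (Fintype.linearCombination Fq g (A a)) = _
    simp only [Fintype.linearCombination_apply, map_sum, map_smul, Matrix.mulVec, dotProduct,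
      vecMul_moore, Matrix.map_apply, ← Algebra.smul_def]
  have hrk := ((linPoly Fq c).domRestrict U).finrank_range_add_finrank_ker
  have h1 : Module.finrank Fq (LinearMap.ker ((linPoly Fq c).domRestrict U)) ≤
      Module.finrank Fq (LinearMap.ker (linPoly Fq c)) := by
    refine LinearMap.finrank_le_finrank_of_injective
      (f := (U.subtype.domRestrict _).codRestrict _ fun y => ?_) ?_
    · have h0 : linPoly Fq c y.1.1 = 0 := y.2
      exact h0
    · intro y z hyz
      exact Subtype.ext (Subtype.ext (Subtype.ext_iff.mp hyz :))
  rw [LinearMap.range_domRestrict, hmap, hU] at hrk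
  unfold rkVec at h
  omega

/-- Every observation of rank at most `k` can be produced by the Gabidulin code of
dimension `k`. -/
theorem exists_moore_mulVec_eq [Finite Fqm] {g : Fin n → Fqm} (hg : LinearIndependent Fq g)
    {μ k : ℕ} (B : Matrix (Fin μ) (Fin n) Fq) (hB : B.rank ≤ k) (y : Fin n → Fqm) :
    ∃ c : Fin n → Fqm, (∀ i : Fin n, k ≤ i → c i = 0) ∧
      B.map (algebraMap Fq Fqm) *ᵥ (c ᵥ* moore Fq g) = B.map (algebraMap Fq Fqm) *ᵥ y := by
  set B' := B.map (algebraMap Fq Fqm) with hB'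
  have hrn : B.rank ≤ n := B.rank_le_width
  let ext : (Fin B.rank → Fqm) →ₗ[Fqm] (Fin n → Fqm) :=
    { toFun := fun u i => if h : (i : ℕ) < B.rank then u ⟨i, h⟩ else 0
      map_add' := fun u v => by ext i; by_cases h : (i : ℕ) < B.rank <;> simp [h]
      map_smul' := fun a u => by ext i; by_cases h : (i : ℕ) < B.rank <;> simp [h] }
  have hext : ∀ u (i : Fin n), B.rank ≤ i → ext u i = 0 := fun u i hi =>
    dif_neg (by omega)
  let T : (Fin B.rank → Fqm) →ₗ[Fqm] (Fin μ → Fqm) :=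
    B'.mulVecLin ∘ₗ (moore Fq g).vecMulLinear ∘ₗ ext
  have hT : ∀ u, T u = B' *ᵥ (ext u ᵥ* moore Fq g) := fun u => rfl
  have hinj : Function.Injective T := by
    rw [injective_iff_map_eq_zero]
    intro u hu
    rw [hT] at hu
    have h0 : ext u = 0 := by
      refine eq_zero_of_rkVec_add_le hg B (hext u) ?_
      rw [← hB', hu]
      have : Submodule.span Fq (Set.range (0 : Fin μ → Fqm)) = ⊥ := by
        rw [Submodule.span_eq_bot]
        rintro _ ⟨_, rfl⟩
        rfl
      simp [rkVec, this]
    ext i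
    have := congrFun h0 ⟨i, by omega⟩
    simpa [ext] using this
  have hrange : LinearMap.range T = LinearMap.range B'.mulVecLin := by
    refine Submodule.eq_of_le_of_finrank_le (LinearMap.range_comp_le_range _ _) ?_
    rw [LinearMap.finrank_range_of_inj hinj, Module.finrank_fin_fun]
    exact rank_map_algebraMap_le B
  obtain ⟨u, hu⟩ : B'.mulVecLin y ∈ LinearMap.range T := hrange ▸ LinearMap.mem_range_self _ y
  exact ⟨ext u, fun i hi => hext u i (hB.trans hi), hu⟩

end Gabidulin

section CosetScheme

variable {Fq Fqm : Type*} [Fintype Fq] [Field Fqm] {α n ℓ : ℕ}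

/-- The coset coding scheme attached to a Gabidulin code and an arrangement `m` of the message
symbols: the first `k₂` coefficients of each row are free, the others are read off the
arrangement. -/
def stairScheme (Fq : Type*) [Fintype Fq] {Fqm : Type*} [Field Fqm] {α n ℓ : ℕ} (g : Fin n → Fqm)
    (k₂ : ℕ) (m : ℕ → ℕ → Option (Fin α × Fin ℓ)) (S : Matrix (Fin α) (Fin ℓ) Fqm) :
    Set (Matrix (Fin α) (Fin n) Fqm) :=
  {X | ∃ c : Matrix (Fin α) (Fin n) Fqm,
    (∀ (r : Fin α) (i : Fin n), k₂ ≤ (i : ℕ) → c r i = (m r (i - k₂)).elim 0 fun x => S x.1 x.2) ∧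
      X = c * moore Fq g}

variable {g : Fin n → Fqm} {k₂ : ℕ} {m : ℕ → ℕ → Option (Fin α × Fin ℓ)}

theorem stairScheme_nonempty (S : Matrix (Fin α) (Fin ℓ) Fqm) :
    (stairScheme Fq g k₂ m S).Nonempty :=
  ⟨_, Matrix.of fun r i => (m r (i - k₂)).elim 0 fun x => S x.1 x.2, fun _ _ _ => rfl, rfl⟩

theorem add_mem_stairScheme {S T : Matrix (Fin α) (Fin ℓ) Fqm}
    {X Y : Matrix (Fin α) (Fin n) Fqm} (hX : X ∈ stairScheme Fq g k₂ m S)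
    (hY : Y ∈ stairScheme Fq g k₂ m T) : X + Y ∈ stairScheme Fq g k₂ m (S + T) := by
  obtain ⟨c, hc, rfl⟩ := hX
  obtain ⟨c', hc', rfl⟩ := hY
  refine ⟨c + c', fun r i hi => ?_, (Matrix.add_mul ..).symm⟩
  rw [Matrix.add_apply, hc r i hi, hc' r i hi]
  cases m r (i - k₂) <;> simp

theorem sub_mem_stairScheme {S T : Matrix (Fin α) (Fin ℓ) Fqm}
    {X Y : Matrix (Fin α) (Fin n) Fqm} (hX : X ∈ stairScheme Fq g k₂ m S)
    (hY : Y ∈ stairScheme Fq g k₂ m T) : X - Y ∈ stairScheme Fq g k₂ m (S - T) := by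
  obtain ⟨c, hc, rfl⟩ := hX
  obtain ⟨c', hc', rfl⟩ := hY
  refine ⟨c - c', fun r i hi => ?_, (Matrix.sub_mul ..).symm⟩
  rw [Matrix.sub_apply, hc r i hi, hc' r i hi]
  cases m r (i - k₂) <;> simp

theorem mul_transpose_row {K : Type*} [CommSemiring K] {N : ℕ} (X : Matrix (Fin α) (Fin n) K)
    (A : Matrix (Fin N) (Fin n) K) (r : Fin α) : (X * Aᵀ) r = A *ᵥ X r := by
  ext a
  simp [Matrix.mul_apply, Matrix.mulVec, dotProduct, mul_comm]

variable [Field Fq] [Algebra Fq Fqm]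

/-- The coset scheme is universally secure under at most `k₂` observations. -/
theorem univSecure_stairScheme [Finite Fqm] (hg : LinearIndependent Fq g) {μ : ℕ} (hμ : μ ≤ k₂) :
    UnivSecure Fq μ (stairScheme Fq g k₂ m) := by
  intro B S₁ S₂ W
  set B' := B.map (algebraMap Fq Fqm)
  obtain ⟨Y, hY⟩ := stairScheme_nonempty (Fq := Fq) (g := g) (k₂ := k₂) (m := m) (S₂ - S₁)
  choose c hc0 hc using fun r =>
    exists_moore_mulVec_eq hg B (B.rank_le_height.trans hμ) (Y r)
  have hZ₀ : Matrix.of c * moore Fq g ∈ stairScheme Fq g k₂ m 0 := by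
    refine ⟨Matrix.of c, fun r i hi => ?_, rfl⟩
    rw [Matrix.of_apply, hc0 r i hi]
    cases m r (i - k₂) <;> simp
  obtain ⟨Z, hZ, hZB⟩ : ∃ Z ∈ stairScheme Fq g k₂ m (S₂ - S₁), Z * B'ᵀ = 0 := by
    refine ⟨Y - Matrix.of c * moore Fq g, by simpa using sub_mem_stairScheme hY hZ₀, ?_⟩
    rw [Matrix.sub_mul, sub_eq_zero]
    funext r
    rw [mul_transpose_row, mul_transpose_row, Matrix.mul_apply_eq_vecMul]
    exact (hc r).symm
  have h₁ : ∀ X, X + Z ∈ stairScheme Fq g k₂ m S₂ ↔ X ∈ stairScheme Fq g k₂ m S₁ := fun X =>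
    ⟨fun h => by simpa using sub_mem_stairScheme h hZ,
      fun h => by simpa using add_mem_stairScheme h hZ⟩
  have h₂ : ∀ X, (X + Z) * B'ᵀ = X * B'ᵀ := fun X => by rw [Matrix.add_mul, hZB, add_zero]
  have hcard : ∀ P Q : Set (Matrix (Fin α) (Fin n) Fqm), (∀ X, X + Z ∈ Q ↔ X ∈ P) →
      P.ncard = Q.ncard := fun P Q h => by
    have : P = (Equiv.addRight Z) ⁻¹' Q := Set.ext fun X => (h X).symm
    rw [this, Set.ncard_preimage_of_injective_subset_range (Equiv.injective _)
      (by rw [Equiv.range_eq_univ]; exact Set.subset_univ _)]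
  rw [hcard _ _ h₁, hcard {X ∈ stairScheme Fq g k₂ m S₁ | X * B'ᵀ = W}
    {X ∈ stairScheme Fq g k₂ m S₂ | X * B'ᵀ = W} fun X => by
      simp only [Set.mem_ofPred_eq, h₁, h₂]]

/-- Suppose the arrangement determines the message from the first `b` rows of the codeword by
decoding codes of dimension `k₂ + a`. If the first `b` rows of the difference of two codewords,
seen through `A`, have rank at most `A.rank - (k₂ + a)`, then the messages agree. -/
theorem stairScheme_message_eq [Finite Fqm] (hg : LinearIndependent Fq g) {a b : ℕ}
    (hm0 : ∀ r i, n ≤ i + k₂ → m r i = none)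
    (hm : ∀ S : Fin α × Fin ℓ → Fqm,
      (∀ r < b, (∀ i, a ≤ i → (m r i).elim 0 S = 0) → ∀ i, (m r i).elim 0 S = 0) → ∀ x, S x = 0)
    (hb : b ≤ α) {N t : ℕ} (A : Matrix (Fin N) (Fin n) Fq) (hA : t + (k₂ + a) ≤ A.rank)
    {S T : Matrix (Fin α) (Fin ℓ) Fqm} {X Y : Matrix (Fin α) (Fin n) Fqm}
    (hX : X ∈ stairScheme Fq g k₂ m S) (hY : Y ∈ stairScheme Fq g k₂ m T)
    (hXY : ∀ r : Fin α, (r : ℕ) < b → rkVec Fq ((X * (A.map (algebraMap Fq Fqm))ᵀ) r -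
      (Y * (A.map (algebraMap Fq Fqm))ᵀ) r) ≤ t) : S = T := by
  obtain ⟨c, hc, hcX⟩ := sub_mem_stairScheme hX hY
  rw [← sub_eq_zero]
  suffices h : ∀ x : Fin α × Fin ℓ, (S - T) x.1 x.2 = 0 from Matrix.ext fun i j => h (i, j)
  refine hm _ fun r hr hz i => ?_
  rcases Nat.lt_or_ge (i + k₂) n with hi | hi
  · have hcr : c ⟨r, by omega⟩ = 0 := by
      refine eq_zero_of_rkVec_add_le (k := k₂ + a) hg A (fun i hi => ?_) (le_trans ?_ hA)
      · rw [hc _ _ (by omega)]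
        exact hz _ (by omega)
      · have := hXY ⟨r, by omega⟩ hr
        rw [mul_transpose_row, mul_transpose_row, ← Matrix.mulVec_sub] at this
        rw [← Matrix.mul_apply_eq_vecMul, ← hcX]
        exact Nat.add_le_add_right this _
    have := hc ⟨r, by omega⟩ ⟨i + k₂, hi⟩ (Nat.le_add_left _ _)
    simpa [hcr] using this.symm
  · rw [hm0 r i hi, Option.elim_none]

end CosetScheme

/-- A decoder exists as soon as distinct messages are never confused. -/
theorem exists_decoder {M O P : Type*} [Nonempty M] (R : M → P → Prop) (f : P → O)
    (h : ∀ S T p p', R S p → R T p' → f p = f p' → S = T) :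
    ∃ D : O → M, ∀ S p, R S p → D (f p) = S := by
  classical
  refine ⟨fun o => if H : ∃ S p, R S p ∧ f p = o then H.choose else Classical.arbitrary M,
    fun S p hp => ?_⟩
  have H : ∃ S' p', R S' p' ∧ f p' = f p := ⟨S, p, hp, rfl⟩
  obtain ⟨p', hp', hf⟩ := H.choose_spec
  simp only [dif_pos H]
  exact h _ _ _ _ hp' hp hf

theorem exists_linearIndependent_of_card {Fq Fqm : Type*} [Field Fq] [Field Fqm] [Algebra Fq Fqm]
    [Fintype Fq] [Fintype Fqm] {n m : ℕ} (hnm : n ≤ m)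
    (hcard : Fintype.card Fqm = Fintype.card Fq ^ m) :
    ∃ g : Fin n → Fqm, LinearIndependent Fq g := by
  rw [Module.card_eq_pow_finrank (K := Fq)] at hcard
  have hrank := Nat.pow_right_injective (Fintype.one_lt_card (α := Fq)) hcard
  exact ⟨_, (Module.finBasis Fq Fqm).linearIndependent.comp (Fin.castLE (hrank ▸ hnm))
    (Fin.castLE_injective _)⟩

/-- coset coding schemes from pairs of Gabidulin codes (`n ≤ m`), with
optimal information rate and universally optimal communication overheads.
Here `d j` is `d_{j+1}` for `j : Fin h`. -/
theorem stmt11 {Fq Fqm : Type*} [Field Fq] [Field Fqm] [Algebra Fq Fqm]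
    [Fintype Fq] [Fintype Fqm]
    (q m n ℓ k₁ k₂ t₀ ρ₀ h α : ℕ) (hq : IsPrimePow q)
    (hm : 0 < m) (hn : 0 < n) (hnm : n ≤ m) (hh : 1 ≤ h)
    (hcq : Fintype.card Fq = q) (hcqm : Fintype.card Fqm = q ^ m)
    (hk : k₂ < k₁) (hk₁ : k₁ ≤ n)
    (ht₀ρ₀ : 2 * t₀ + ρ₀ = n - k₁)
    (hℓ : ℓ = k₁ - k₂)
    (d : Fin h → ℕ) (hd_anti : StrictAnti d) (hd_le : d ⟨0, by omega⟩ ≤ n)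
    (hd_last : d ⟨h - 1, by omega⟩ = n - ρ₀)
    (hα : α = Finset.univ.lcm fun j : Fin h => d j - 2 * t₀ - k₂) :
    ∃ CS : Matrix (Fin α) (Fin ℓ) Fqm → Set (Matrix (Fin α) (Fin n) Fqm),
      (∀ S, (CS S).Nonempty) ∧
      (∀ S T, S ≠ T → Disjoint (CS S) (CS T)) ∧
      (∀ t ρ : ℕ, 2 * t + ρ ≤ n - k₁ → UnivCorrecting Fq t ρ CS) ∧
      (∀ μ : ℕ, μ ≤ k₂ → UnivSecure Fq μ CS) ∧
      (∀ j : Fin h, ∀ A : Matrix (Fin (d j)) (Fin n) Fq, A.rank = d j →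
        ∃ β : ℕ, β * (d j - 2 * t₀ - k₂) = ℓ * α ∧
          ∃ EA : Fin (d j) → (Fin α → Fqm) → (Fin β → Fqm),
            PreprocCorrecting Fq t₀ A (β := fun _ => β) EA CS ∧
            ((d j : ℚ) * β / α - ℓ
              = (ℓ : ℚ) * (2 * (t₀ : ℚ) + (k₂ : ℚ))
                / ((d j : ℚ) - 2 * (t₀ : ℚ) - (k₂ : ℚ)))) := by
  subst hcq
  obtain ⟨g, hg⟩ := exists_linearIndependent_of_card (Fq := Fq) hnm hcqm
  have hd_ge : ∀ j, n - ρ₀ ≤ d j := fun j => hd_last ▸ hd_anti.antitone (by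
    rw [Fin.le_def]; dsimp only; omega)
  have hd_le' : ∀ j, d j ≤ n := fun j =>
    (hd_anti.antitone (Fin.le_def.mpr (Nat.zero_le _))).trans hd_le
  have hℓ_le : ∀ j, ℓ ≤ d j - 2 * t₀ - k₂ := fun j => by have := hd_ge j; omega
  have hdvd : ∀ j, d j - 2 * t₀ - k₂ ∣ α := fun j =>
    hα ▸ Finset.dvd_lcm (f := fun j : Fin h => d j - 2 * t₀ - k₂) (Finset.mem_univ j)
  have hαpos : 0 < α := by
    rw [Nat.pos_iff_ne_zero, hα, Ne, Finset.lcm_eq_zero_iff]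
    rintro ⟨j, -, hj⟩
    have := hℓ_le j
    omega
  let ix : ℕ → Fin h := fun j => ⟨min j (h - 1), by omega⟩
  let a : ℕ → ℕ := fun j => d (ix j) - 2 * t₀ - k₂
  let b : ℕ → ℕ := fun j => ℓ * α / a j
  have haℓ : ∀ j, ℓ ≤ a j := fun j => hℓ_le (ix j)
  have ha : Antitone a := fun i j hij => by
    have : d (ix j) ≤ d (ix i) := hd_anti.antitone (by simp only [ix, Fin.mk_le_mk]; omega)
    simp only [a]
    omega
  have hb : Monotone b := fun i j hij =>
    Nat.div_le_div_left (ha hij) (by have := haℓ j; omega)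
  have hab : ∀ j, b j * a j = ℓ * α := fun j => Nat.div_mul_cancel ((hdvd (ix j)).mul_left ℓ)
  have hbα : ∀ j, b j ≤ α := fun j => Nat.div_le_of_le_mul (Nat.mul_le_mul_right _ (haℓ j))
  have hixj : ∀ j : Fin h, ix j = j := fun j => by ext; simp only [ix]; omega
  have : Nonempty (Fin α × Fin ℓ) := ⟨⟨0, hαpos⟩, ⟨0, by omega⟩⟩
  obtain ⟨σ, hσ0, hσ⟩ := exists_staircase (ι := Fin α × Fin ℓ) (K := Fqm) a b ha hb
    (fun j => by rw [hab, Fintype.card_prod, Fintype.card_fin, Fintype.card_fin, mul_comm]) (h - 1)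
  have hσn : ∀ r i, n ≤ i + k₂ → σ r i = none := fun r i hi => hσ0 r i (by
    have := hd_le' (ix 0)
    simp only [a]
    omega)
  have key : ∀ j : Fin h, ∀ {N t : ℕ} (A : Matrix (Fin N) (Fin n) Fq),
      t + (d j - 2 * t₀) ≤ A.rank → ∀ S T X Y, X ∈ stairScheme Fq g k₂ σ S →
      Y ∈ stairScheme Fq g k₂ σ T →
      (∀ r : Fin α, (r : ℕ) < b j → rkVec Fq ((X * (A.map (algebraMap Fq Fqm))ᵀ) r -
        (Y * (A.map (algebraMap Fq Fqm))ᵀ) r) ≤ t) → S = T := by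
    intro j N t A hA S T X Y hX hY hXY
    refine stairScheme_message_eq hg hσn (fun S => hσ S j (by omega)) (hbα j) A ?_ hX hY hXY
    have h1 := hd_ge j
    simp only [a, hixj]
    omega
  refine ⟨stairScheme Fq g k₂ σ, stairScheme_nonempty, fun S T hST => ?_,
    fun t ρ htρ N hN A hA => ?_, fun μ hμ => univSecure_stairScheme hg hμ, fun j A hA => ?_⟩
  · rw [Set.disjoint_left]
    refine fun X hX hX' => hST ?_
    refine key ⟨h - 1, by omega⟩ (t := 0) (1 : Matrix (Fin n) (Fin n) Fq) ?_ S T X X hX hX' ?_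
    · rw [Matrix.rank_one, Fintype.card_fin]
      have := hd_le' ⟨h - 1, by omega⟩
      omega
    · intro r _
      have : Submodule.span Fq (Set.range (0 : Fin n → Fqm)) = ⊥ := by
        rw [Submodule.span_eq_bot]
        rintro _ ⟨_, rfl⟩
        rfl
      simp [rkVec, this]
  · obtain ⟨D, hD⟩ := exists_decoder
      (fun S (p : Matrix (Fin α) (Fin n) Fqm × Matrix (Fin α) (Fin N) Fqm) =>
        p.1 ∈ stairScheme Fq g k₂ σ S ∧ rkMat Fq p.2 ≤ t)
      (fun p => p.1 * (A.map (algebraMap Fq Fqm))ᵀ + p.2) (by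
        rintro S T ⟨X, E⟩ ⟨Y, E'⟩ ⟨hX, hE⟩ ⟨hY, hE'⟩ hf
        refine key ⟨h - 1, by omega⟩ (t := 2 * t) A (by rw [hd_last]; omega) S T X Y hX hY ?_
        intro r _
        have hrow : (X * (A.map (algebraMap Fq Fqm))ᵀ) r - (Y * (A.map (algebraMap Fq Fqm))ᵀ) r
            = E' r - E r := by
          rw [sub_eq_sub_iff_add_eq_add, add_comm (E' r)]
          exact congrFun hf r
        rw [hrow]
        have := rkVec_sub_le_s11 (Fq := Fq) E' E r
        simp only at hE hE'
        omega)
    exact ⟨D, fun S X E hX hE => hD S (X, E) ⟨hX, hE⟩⟩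
  · have hbj : b j * (d j - 2 * t₀ - k₂) = ℓ * α := by
      have := hab j
      simpa only [a, hixj] using this
    refine ⟨b j, hbj, fun _ y i => y (Fin.castLE (hbα j) i), ?_, ?_⟩
    · obtain ⟨D, hD⟩ := exists_decoder
        (fun S (p : Matrix (Fin α) (Fin n) Fqm × Matrix (Fin α) (Fin (d j)) Fqm) =>
          p.1 ∈ stairScheme Fq g k₂ σ S ∧ rkMat Fq p.2 ≤ t₀)
        (fun p (i : Fin (d j)) (s : Fin (b j)) =>
          (p.1 * (A.map (algebraMap Fq Fqm))ᵀ) (Fin.castLE (hbα j) s) i +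
            p.2 (Fin.castLE (hbα j) s) i) (by
          rintro S T ⟨X, E⟩ ⟨Y, E'⟩ ⟨hX, hE⟩ ⟨hY, hE'⟩ hf
          refine key j (t := 2 * t₀) A (by have := hd_ge j; omega) S T X Y hX hY ?_
          intro r hr
          have hrow : (X * (A.map (algebraMap Fq Fqm))ᵀ) r -
              (Y * (A.map (algebraMap Fq Fqm))ᵀ) r = E' r - E r := by
            rw [sub_eq_sub_iff_add_eq_add, add_comm (E' r)]
            funext i
            exact congrFun (congrFun hf i) ⟨r, hr⟩
          rw [hrow]
          have := rkVec_sub_le_s11 (Fq := Fq) E' E r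
          simp only at hE hE'
          omega)
      exact ⟨D, fun S X E hX hE => hD S (X, E) ⟨hX, hE⟩⟩
    · have h1 := hd_ge j
      have hpos : 0 < d j - 2 * t₀ - k₂ := by omega
      have hcast : ((d j - 2 * t₀ - k₂ : ℕ) : ℚ) = (d j : ℚ) - 2 * t₀ - k₂ := by
        rw [Nat.cast_sub (by omega), Nat.cast_sub (by omega)]
        push_cast
        ring
      have hne : (d j : ℚ) - 2 * t₀ - k₂ ≠ 0 := by
        rw [← hcast]
        exact_mod_cast hpos.ne'
      have hα0 : (α : ℚ) ≠ 0 := by exact_mod_cast hαpos.ne'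
      have hbq : (b j : ℚ) * ((d j : ℚ) - 2 * t₀ - k₂) = ℓ * α := by
        rw [← hcast]
        exact_mod_cast hbj
      rw [eq_div_iff hne, sub_mul, div_mul_eq_mul_div, mul_assoc, hbq]
      field_simp
      ring
end
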